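/- Let H be a complex separable Hilbert space with dim H ≥ 2 and let A = L + iB, where L is a bounded self-adjoint operator on H and B is a self-adjoint Hilbert–Schmidt operator on H (i.e., for some, equivalently every, Hilbert basis (eᵢ) of H, Σᵢ ‖B eᵢ‖² < ∞). Then A has a nontrivial closed invariant subspace: there exists a closed subspace M of H with M ≠ {0}, M ≠ H, and A(M) ⊆ M. -/

import Mathlib

section

open Finset

/-- The strictly lower triangular matrix `N`, as an operator on sequences. -/
def lowerOp (N : ℕ → ℕ → ℝ) : Module.End ℝ (ℕ → ℝ) where
  toFun w i := ∑ j ∈ range i, N i j * w j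
  map_add' u v := by ext i; simp [mul_add, sum_add_distrib]
  map_smul' c v := by ext i; simp [mul_sum, mul_left_comm]

lemma pow_succ_add_mul_le {x y : ℝ} (hx : 0 ≤ x) (hy : 0 ≤ y) (k : ℕ) :
    x ^ (k + 1) + (k + 1) * (y * x ^ k) ≤ (x + y) ^ (k + 1) := by
  induction k with
  | zero => simp
  | succ k ih =>
    have h := mul_le_mul_of_nonneg_right ih (add_nonneg hx hy)
    have h2 : 0 ≤ (k + 1) * (y * x ^ k) * y := by positivity
    rw [pow_succ (x + y)]
    refine le_trans ?_ h
    push_cast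
    ring_nf at h2 ⊢
    nlinarith

lemma sum_mul_sum_pow_le {a : ℕ → ℝ} (ha : ∀ i, 0 ≤ a i) (k n : ℕ) :
    ∑ l ∈ range n, a l * (∑ i ∈ range l, a i) ^ k ≤ (∑ i ∈ range n, a i) ^ (k + 1) / (k + 1) := by
  induction n with
  | zero => simp
  | succ n ih =>
    have hk : (0 : ℝ) < k + 1 := by positivity
    rw [sum_range_succ, sum_range_succ _ n, le_div_iff₀ hk]
    rw [le_div_iff₀ hk] at ih
    have := pow_succ_add_mul_le (sum_nonneg fun i (_ : i ∈ range n) => ha i) (ha n) k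
    linarith

/-- Powers of a strictly lower triangular matrix decay like the inverse square root of the
factorial, with respect to the Hilbert–Schmidt norm. -/
lemma sum_sq_lowerOp_pow_le (N : ℕ → ℕ → ℝ) (w : ℕ → ℝ) (k n : ℕ) :
    ∑ i ∈ range n, ((lowerOp N ^ k) w i) ^ 2 ≤
      (∑ i ∈ range n, ∑ j ∈ range i, N i j ^ 2) ^ k / k.factorial * ∑ i ∈ range n, w i ^ 2 := by
  induction k generalizing n with
  | zero => simp
  | succ k ih =>
    set a : ℕ → ℝ := fun i => ∑ j ∈ range i, N i j ^ 2
    have ha : ∀ i, 0 ≤ a i := fun i => sum_nonneg fun _ _ => sq_nonneg _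
    have hW : 0 ≤ ∑ i ∈ range n, w i ^ 2 := sum_nonneg fun _ _ => sq_nonneg _
    have key : ∀ l ∈ range n, ((lowerOp N ^ (k + 1)) w l) ^ 2 ≤
        (a l * (∑ i ∈ range l, a i) ^ k) * ((∑ i ∈ range n, w i ^ 2) / k.factorial) := by
      intro l hl
      have h1 : (lowerOp N ^ (k + 1)) w l = ∑ j ∈ range l, N l j * (lowerOp N ^ k) w j := by
        rw [pow_succ']; rfl
      rw [h1]
      calc _ ≤ a l * ∑ j ∈ range l, ((lowerOp N ^ k) w j) ^ 2 := sum_mul_sq_le_sq_mul_sq _ _ _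
        _ ≤ a l * ((∑ i ∈ range l, a i) ^ k / k.factorial * ∑ i ∈ range l, w i ^ 2) :=
          mul_le_mul_of_nonneg_left (ih l) (ha l)
        _ ≤ a l * ((∑ i ∈ range l, a i) ^ k / k.factorial * ∑ i ∈ range n, w i ^ 2) := by
          have : ∑ i ∈ range l, w i ^ 2 ≤ ∑ i ∈ range n, w i ^ 2 :=
            sum_le_sum_of_subset_of_nonneg (range_subset_range.2 (mem_range.1 hl).le)
              fun _ _ _ => sq_nonneg _
          have h0 : 0 ≤ ∑ i ∈ range l, a i := sum_nonneg fun _ _ => ha _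
          have := ha l
          gcongr
        _ = _ := by ring
    refine (sum_le_sum key).trans ?_
    rw [← sum_mul]
    refine (mul_le_mul_of_nonneg_right (sum_mul_sum_pow_le ha k n) (by positivity)).trans_eq ?_
    rw [Nat.factorial_succ]
    push_cast
    field_simp

/-- The Euclidean norm of the first `n` entries of a sequence. -/
noncomputable def headNorm (n : ℕ) (w : ℕ → ℝ) : ℝ := √(∑ i ∈ range n, w i ^ 2)

lemma headNorm_sum_le {ι : Type*} (n : ℕ) (s : Finset ι) (w : ι → ℕ → ℝ) :
    headNorm n (∑ k ∈ s, w k) ≤ ∑ k ∈ s, headNorm n (w k) := by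
  have h : ∀ u : ℕ → ℝ, headNorm n u = ‖WithLp.toLp 2 fun i : Fin n => u i‖ := fun u => by
    simp [headNorm, EuclideanSpace.norm_eq, sum_range]
  simp only [h]
  refine le_of_eq_of_le ?_ (norm_sum_le _ _)
  congr 1
  ext i
  simp

lemma headNorm_smul (n : ℕ) {c : ℝ} (hc : 0 ≤ c) (w : ℕ → ℝ) :
    headNorm n (c • w) = c * headNorm n w := by
  simp only [headNorm, Pi.smul_apply, smul_eq_mul, mul_pow, ← mul_sum]
  rw [Real.sqrt_mul (sq_nonneg c), Real.sqrt_sq hc]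

lemma headNorm_mono (n : ℕ) {u w : ℕ → ℝ} (h : ∀ i, |u i| ≤ w i) :
    headNorm n u ≤ headNorm n w :=
  Real.sqrt_le_sqrt <| sum_le_sum fun i _ => sq_le_sq.2 ((h i).trans (le_abs_self _))

lemma headNorm_lowerOp_pow_le (N : ℕ → ℕ → ℝ) {c : ℝ} (hc : 0 ≤ c) (n : ℕ)
    (hN : ∑ i ∈ range n, ∑ j ∈ range i, N i j ^ 2 ≤ c ^ 2) (w : ℕ → ℝ) (k : ℕ) :
    headNorm n ((lowerOp N ^ k) w) ≤ c ^ k / √k.factorial * headNorm n w := by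
  refine Real.sqrt_le_iff.2 ⟨by unfold headNorm; positivity, ?_⟩
  refine (sum_sq_lowerOp_pow_le N w k n).trans ?_
  have h0 : 0 ≤ ∑ i ∈ range n, w i ^ 2 := sum_nonneg fun _ _ => sq_nonneg _
  have h1 : 0 ≤ ∑ i ∈ range n, ∑ j ∈ range i, N i j ^ 2 :=
    sum_nonneg fun _ _ => sum_nonneg fun _ _ => sq_nonneg _
  rw [mul_pow, div_pow, headNorm, Real.sq_sqrt h0, Real.sq_sqrt (Nat.cast_nonneg _), ← pow_mul,
    mul_comm k 2, pow_mul]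
  gcongr

lemma headNorm_add_lowerOp_pow_le (N : ℕ → ℕ → ℝ) {c ρ : ℝ} (hc : 0 ≤ c) (hρ : 0 ≤ ρ) (n : ℕ)
    (hN : ∑ i ∈ range n, ∑ j ∈ range i, N i j ^ 2 ≤ c ^ 2) (w : ℕ → ℝ) (m : ℕ) :
    headNorm n (((lowerOp N + algebraMap ℝ _ ρ) ^ m) w) ≤
      (∑ k ∈ range (m + 1), m.choose k * ρ ^ (m - k) * (c ^ k / √k.factorial)) *
        headNorm n w := by
  have h : ((lowerOp N + algebraMap ℝ _ ρ) ^ m) w =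
      ∑ k ∈ range (m + 1), (m.choose k * ρ ^ (m - k)) • (lowerOp N ^ k) w := by
    rw [Commute.add_pow (Algebra.commutes ρ (lowerOp N)).symm, LinearMap.sum_apply]
    refine sum_congr rfl fun k _ => ?_
    rw [← map_pow, ← map_natCast (algebraMap ℝ (Module.End ℝ (ℕ → ℝ))), mul_assoc, ← map_mul,
      ← Algebra.commutes, ← Algebra.smul_def, LinearMap.smul_apply, mul_comm (ρ ^ _)]
  rw [h, sum_mul]
  refine (headNorm_sum_le _ _ _).trans (sum_le_sum fun k _ => ?_)
  rw [headNorm_smul n (by positivity)]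
  exact (mul_le_mul_of_nonneg_left (headNorm_lowerOp_pow_le N hc n hN w k)
    (by positivity)).trans_eq (by ring)

lemma hasEigenvalue_of_forall_inner_eq_zero {V : Type*} [NormedAddCommGroup V]
    [InnerProductSpace ℂ V] [FiniteDimensional ℂ V] (T : Module.End ℂ V) (μ : ℂ) {v : V}
    (hv : v ≠ 0) (h : ∀ x, inner ℂ v (T x - μ • x) = 0) : T.HasEigenvalue μ := by
  rw [Module.End.hasEigenvalue_iff, Module.End.eigenspace_def]
  intro hker
  have hinj : Function.Injective (T - algebraMap ℂ (Module.End ℂ V) μ) :=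
      LinearMap.ker_eq_bot.1 hker
  obtain ⟨x, hx⟩ := LinearMap.injective_iff_surjective.1 hinj v
  have := h x
  rw [show T x - μ • x = v by simpa [Module.algebraMap_end_apply] using hx,
    inner_self_eq_zero] at this
  exact hv this

/-- Schur triangularization: every operator on a finite-dimensional inner product space is lower
triangular in some orthonormal basis, with eigenvalues on the diagonal. -/
lemma exists_orthonormal_triangular (n : ℕ) : ∀ (V : Type*) [NormedAddCommGroup V]
    [InnerProductSpace ℂ V] [FiniteDimensional ℂ V] (_ : Module.finrank ℂ V = n)
    (T : Module.End ℂ V), ∃ b : Fin n → V, Orthonormal ℂ b ∧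
      (∀ i j, i < j → inner ℂ (b i) (T (b j)) = 0) ∧
      ∀ i, T.HasEigenvalue (inner ℂ (b i) (T (b i))) := by
  induction n with
  | zero =>
    intro V _ _ _ _ T
    exact ⟨fun i => i.elim0, ⟨fun i => i.elim0, fun i => i.elim0⟩, fun i => i.elim0,
      fun i => i.elim0⟩
  | succ n ih =>
    intro V _ _ _ hV T
    have : Nontrivial V := Module.nontrivial_of_finrank_pos (R := ℂ) (by omega)
    obtain ⟨μ, hμ⟩ := Module.End.exists_eigenvalue (LinearMap.adjoint T)
    obtain ⟨u, hu⟩ := hμ.exists_hasEigenvector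
    obtain ⟨v, hv1, hv⟩ : ∃ v : V, ‖v‖ = 1 ∧ LinearMap.adjoint T v = μ • v := by
      refine ⟨((‖u‖⁻¹ : ℝ) : ℂ) • u, ?_, ?_⟩
      · have := norm_ne_zero_iff.2 hu.2
        simp [norm_smul, this]
      · rw [map_smul, hu.apply_eq_smul, smul_comm]
    have hv0 : v ≠ 0 := fun h => by simp [h] at hv1
    have hvT : ∀ x, inner ℂ v (T x) = starRingEnd ℂ μ * inner ℂ v x := fun x => by
      rw [← LinearMap.adjoint_inner_left, hv, inner_smul_left]
    set S := (Submodule.span ℂ {v})ᗮ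
    have hmem : ∀ x, x ∈ S ↔ inner ℂ v x = 0 := fun x =>
        Submodule.mem_orthogonal_singleton_iff_inner_right
    have hS : ∀ x ∈ S, T x ∈ S := fun x hx => by
      rw [hmem] at hx ⊢
      rw [hvT, hx, mul_zero]
    have hfin : Module.finrank ℂ S = n := by
      have : Fact (Module.finrank ℂ V = n + 1) := ⟨hV⟩
      exact Submodule.finrank_orthogonal_span_singleton hv0
    obtain ⟨b, hb, hb2, hb3⟩ := ih S hfin (T.restrict hS)
    refine ⟨Fin.cons v fun i => (b i : V), ?_, ?_, ?_⟩
    · rw [orthonormal_iff_ite] at hb ⊢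
      intro i j
      refine Fin.cases ?_ (fun i => ?_) i <;> refine Fin.cases ?_ (fun j => ?_) j
      · simp [inner_self_eq_norm_sq_to_K, hv1]
      · simpa [eq_comm] using (hmem _).1 (b j).2
      · simpa [eq_comm] using inner_eq_zero_symm.1 ((hmem _).1 (b i).2)
      · simpa using hb i j
    · intro i j
      refine Fin.cases ?_ (fun i => ?_) i <;> refine Fin.cases ?_ (fun j => ?_) j
      · simp
      · intro _
        simpa using (hmem _).1 (hS _ (b j).2)
      · simp
      · intro h
        simpa using hb2 i j (by simpa using h)
    · intro i
      refine Fin.cases ?_ (fun i => ?_) i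
      · refine hasEigenvalue_of_forall_inner_eq_zero T _ hv0 fun x => ?_
        rw [inner_sub_right, inner_smul_right, Fin.cons_zero, hvT, hvT,
          inner_self_eq_norm_sq_to_K, hv1]
        simp
      · obtain ⟨x, hx⟩ := (hb3 i).exists_hasEigenvector
        refine Module.End.hasEigenvalue_of_hasEigenvector (x := (x : V)) ⟨?_, by simpa using hx.2⟩
        rw [Module.End.mem_eigenspace_iff]
        simpa using congrArg (Subtype.val) hx.apply_eq_smul
lemma norm_add_mul_I_le {s t ε R : ℝ} {μ : ℂ} (him : |μ.im| ≤ ε) (hre : |μ.re| ≤ R) :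
    ‖(s : ℂ) + t * Complex.I * μ‖ ≤ √((|s| + |t| * ε) ^ 2 + t ^ 2 * R ^ 2) := by
  rw [Complex.norm_def, Complex.normSq_apply]
  refine Real.sqrt_le_sqrt ?_
  have h1 : ((s : ℂ) + t * Complex.I * μ).re = s - t * μ.im := by simp; ring
  have h2 : ((s : ℂ) + t * Complex.I * μ).im = t * μ.re := by simp
  rw [h1, h2, ← sq, ← sq, mul_pow]
  have h3 : |s - t * μ.im| ≤ |s| + |t| * ε := by
    refine (abs_sub _ _).trans ?_
    rw [abs_mul]
    gcongr
  gcongr ?_ + t ^ 2 * ?_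
  · exact sq_le_sq.2 (h3.trans (le_abs_self _))
  · exact sq_le_sq.2 (hre.trans (le_abs_self _))

/-- Powers of `s + i t T` for a finite-dimensional operator `T` with almost real spectrum and small
imaginary part. -/
lemma norm_add_mul_I_smul_pow_le {V : Type*} [NormedAddCommGroup V] [InnerProductSpace ℂ V]
    [FiniteDimensional ℂ V] (T : Module.End ℂ V) {ε R c : ℝ} (hc : 0 ≤ c)
    (heig : ∀ μ, T.HasEigenvalue μ → |μ.im| ≤ ε ∧ |μ.re| ≤ R)
    (hHS : ∀ b : Fin (Module.finrank ℂ V) → V, Orthonormal ℂ b →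
      ∑ i, ∑ j, ‖inner ℂ (b i) (T (b j)) - starRingEnd ℂ (inner ℂ (b j) (T (b i)))‖ ^ 2 ≤ c ^ 2)
    (s t : ℝ) (m : ℕ) (y : V) :
    ‖((algebraMap ℂ (Module.End ℂ V) s + ((t : ℂ) * Complex.I) • T) ^ m) y‖ ≤
      (∑ k ∈ range (m + 1), m.choose k * √((|s| + |t| * ε) ^ 2 + t ^ 2 * R ^ 2) ^ (m - k) *
        ((|t| * c) ^ k / √k.factorial)) * ‖y‖ := by
  set n := Module.finrank ℂ V with hn
  obtain ⟨b, hb, hlow, hdiag⟩ := exists_orthonormal_triangular n V hn.symm T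
  set ρ := √((|s| + |t| * ε) ^ 2 + t ^ 2 * R ^ 2)
  set W := algebraMap ℂ (Module.End ℂ V) s + ((t : ℂ) * Complex.I) • T
  have hρ : 0 ≤ ρ := Real.sqrt_nonneg _
  let B : OrthonormalBasis (Fin n) ℂ V := OrthonormalBasis.mk hb
    (by rw [hb.linearIndependent.span_eq_top_of_card_eq_finrank' (by simp [hn])])
  have hB : ∀ i, B i = b i := fun i => by simp [B]
  let b' : ℕ → V := fun i => if h : i < n then b ⟨i, h⟩ else 0
  have hb' : ∀ i : Fin n, b' i = b i := fun i => by simp [b']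
  let q : V → ℕ → ℝ := fun y i => ‖inner ℂ (b' i) y‖
  have hq : ∀ y, headNorm n (q y) = ‖y‖ := fun y => by
    rw [headNorm, sum_range]
    simp only [q, hb', ← hB]
    rw [B.sum_sq_norm_inner_right, Real.sqrt_sq (norm_nonneg _)]
  let N : ℕ → ℕ → ℝ := fun i j => |t| * ‖inner ℂ (b' i) (T (b' j))‖
  have hNnn : ∀ i j, 0 ≤ N i j := fun i j => by positivity
  have hexp : ∀ y, y = ∑ j ∈ range n, inner ℂ (b' j) y • b' j := fun y => by
    rw [sum_range]
    simp only [hb', ← hB]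
    exact (B.sum_repr' y).symm
  have hlow' : ∀ i j, i < j → inner ℂ (b' i) (T (b' j)) = 0 := fun i j hij => by
    by_cases hj : j < n
    · have hi : i < n := hij.trans hj
      simpa [b', hi, hj] using hlow ⟨i, hi⟩ ⟨j, hj⟩ hij
    · simp [b', hj]
  have hcoord : ∀ y i, i < n → inner ℂ (b' i) (W y) =
      ((s : ℂ) + t * Complex.I * inner ℂ (b' i) (T (b' i))) * inner ℂ (b' i) y +
        ∑ j ∈ range i, t * Complex.I * inner ℂ (b' i) (T (b' j)) * inner ℂ (b' j) y := by
    intro y i hi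
    have h1 : inner ℂ (b' i) (T y) =
        ∑ j ∈ range (i + 1), inner ℂ (b' j) y * inner ℂ (b' i) (T (b' j)) := by
      conv_lhs => rw [hexp y]
      rw [map_sum, inner_sum]
      simp only [map_smul, inner_smul_right]
      refine (sum_subset (range_subset_range.2 hi) fun j _ hj => ?_).symm
      rw [hlow' i j (by simpa using hj), mul_zero]
    simp only [W, LinearMap.add_apply, Module.algebraMap_end_apply, LinearMap.smul_apply,
      inner_add_right, inner_smul_right]
    rw [h1, sum_range_succ, mul_add, mul_sum]
    have : ∀ j, t * Complex.I * inner ℂ (b' i) (T (b' j)) * inner ℂ (b' j) y =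
      t * Complex.I * (inner ℂ (b' j) y * inner ℂ (b' i) (T (b' j))) := fun j => by ring
    simp only [this]
    ring
  have hstep : ∀ (u : V) (w : ℕ → ℝ), (∀ i, q u i ≤ w i) →
      ∀ i, q (W u) i ≤ (lowerOp N + algebraMap ℝ _ ρ) w i := by
    intro u w huw i
    have hw : ∀ i, 0 ≤ w i := fun i => (norm_nonneg _).trans (huw i)
    have hval : (lowerOp N + algebraMap ℝ _ ρ) w i = (∑ j ∈ range i, N i j * w j) + ρ * w i := rfl
    rw [hval]
    by_cases hi : i < n
    · simp only [q]
      rw [hcoord u i hi, add_comm]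
      refine (norm_add_le _ _).trans (add_le_add ((norm_sum_le _ _).trans
        (sum_le_sum fun j _ => ?_)) ?_)
      · simp only [norm_mul, Complex.norm_I, mul_one, Complex.norm_real, Real.norm_eq_abs]
        exact mul_le_mul_of_nonneg_left (huw j) (hNnn i j)
      · rw [norm_mul]
        refine mul_le_mul ?_ (huw i) (norm_nonneg _) hρ
        obtain ⟨h1, h2⟩ := heig _ (hdiag ⟨i, hi⟩)
        simpa [b', hi] using norm_add_mul_I_le h1 h2
    · have : q (W u) i = 0 := by simp [q, b', hi]
      rw [this]
      exact add_nonneg (sum_nonneg fun j _ => mul_nonneg (hNnn i j) (hw j)) (mul_nonneg hρ (hw i))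
  have hpow : ∀ m i, q ((W ^ m) y) i ≤ ((lowerOp N + algebraMap ℝ _ ρ) ^ m) (q y) i := by
    intro m
    induction m with
    | zero => simp
    | succ m ih =>
      rw [pow_succ', pow_succ']
      exact hstep _ _ ih
  have hN : ∑ i ∈ range n, ∑ j ∈ range i, N i j ^ 2 ≤ (|t| * c) ^ 2 := by
    have h1 : ∀ i ∈ range n, ∑ j ∈ range i, N i j ^ 2 ≤ t ^ 2 * ∑ j ∈ range n,
        ‖inner ℂ (b' i) (T (b' j)) - starRingEnd ℂ (inner ℂ (b' j) (T (b' i)))‖ ^ 2 := by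
      intro i hi
      rw [mul_sum]
      refine (sum_le_sum fun j hj => ?_).trans (sum_le_sum_of_subset_of_nonneg
        (range_subset_range.2 (mem_range.1 hi).le) fun _ _ _ => by positivity)
      rw [hlow' j i (mem_range.1 hj)]
      simp [N, mul_pow]
    refine (sum_le_sum h1).trans ?_
    rw [← mul_sum, mul_pow, sq_abs]
    refine mul_le_mul_of_nonneg_left ?_ (sq_nonneg t)
    rw [sum_range]
    simp only [sum_range _, hb']
    exact hHS b hb
  rw [← hq, ← hq y]
  refine le_trans (headNorm_mono n fun i => ?_)
    (headNorm_add_lowerOp_pow_le N (by positivity) hρ n hN _ m)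
  rw [abs_of_nonneg (norm_nonneg _)]
  exact hpow m i

section HilbertSchmidt

variable {H : Type*} [NormedAddCommGroup H] [InnerProductSpace ℂ H] {ι : Type*}

lemma hasSum_norm_inner_sq (e : HilbertBasis ι ℂ H) (y : H) :
    HasSum (fun i => ‖inner ℂ (e i) y‖ ^ 2) (‖y‖ ^ 2) := by
  have h := (e.hasSum_inner_mul_inner y y).mapL Complex.reCLM
  rw [Complex.reCLM_apply, inner_self_eq_norm_sq_to_K] at h
  convert h using 1
  · ext i
    rw [Complex.reCLM_apply, ← inner_conj_symm y, mul_comm, Complex.mul_conj,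
      Complex.normSq_eq_norm_sq, Complex.ofReal_re]
  · norm_cast

variable [CompleteSpace H]

lemma sum_norm_apply_orthonormal_sq_le {B : H →L[ℂ] H} (hB : IsSelfAdjoint B)
    (e : HilbertBasis ι ℂ H) (hs : Summable fun i => ‖B (e i)‖ ^ 2) {n : ℕ} {b : Fin n → H}
    (hb : Orthonormal ℂ b) : ∑ j, ‖B (b j)‖ ^ 2 ≤ ∑' i, ‖B (e i)‖ ^ 2 := by
  have h1 : HasSum (fun i => ∑ j, ‖inner ℂ (e i) (B (b j))‖ ^ 2) (∑ j, ‖B (b j)‖ ^ 2) :=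
    hasSum_sum fun j _ => hasSum_norm_inner_sq e (B (b j))
  rw [← h1.tsum_eq]
  refine h1.summable.tsum_le_tsum (fun i => ?_) hs
  have h2 : ∀ j, ‖inner ℂ (e i) (B (b j))‖ = ‖inner ℂ (b j) (B (e i))‖ := fun j => by
    rw [← hB.isSymmetric.apply_clm (e i) (b j), norm_inner_symm]
  simp only [h2]
  exact hb.sum_inner_products_le _

lemma isCompactOperator_of_hilbertSchmidt {B : H →L[ℂ] H} (hB : IsSelfAdjoint B)
    (e : HilbertBasis ι ℂ H) (hs : Summable fun i => ‖B (e i)‖ ^ 2) : IsCompactOperator B := by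
  classical
  let K : Finset ι → H →L[ℂ] H := fun F =>
    ∑ i ∈ F, ((innerSL ℂ (e i)).smulRight (e i)) ∘L B
  have hK : ∀ F, IsCompactOperator (K F) := fun F => by
    have : K F ∈ compactOperator (RingHom.id ℂ) H H := by
      refine Submodule.sum_mem _ fun i _ => ?_
      have h1 : IsCompactOperator ((innerSL ℂ (e i)) ∘L B) :=
        isCompactOperator_of_locallyCompactSpace_dom _
      exact h1.clm_comp ((ContinuousLinearMap.id ℂ ℂ).smulRight (e i))
    exact this
  have hlim : Filter.Tendsto (fun F : Finset ι => √(∑' i, ‖B (e i)‖ ^ 2 - ∑ i ∈ F, ‖B (e i)‖ ^ 2))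
      Filter.atTop (nhds 0) := by
    have h := (Filter.Tendsto.const_sub (∑' i, ‖B (e i)‖ ^ 2) hs.hasSum).sqrt
    rwa [sub_self, Real.sqrt_zero] at h
  refine isCompactOperator_of_tendsto (F := K) (l := Filter.atTop) ?_
      (Filter.Eventually.of_forall hK)
  rw [tendsto_iff_norm_sub_tendsto_zero]
  refine squeeze_zero (fun _ => norm_nonneg _) (fun F => ?_) hlim
  refine ContinuousLinearMap.opNorm_le_bound _ (Real.sqrt_nonneg _) fun x => ?_
  have hin : ∀ i, inner ℂ (e i) ((K F - B) x) =
      if i ∈ F then 0 else - inner ℂ (e i) (B x) := fun i => by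
    have : ∀ j, inner ℂ (e i) (e j) = if i = j then (1 : ℂ) else 0 :=
      fun j => orthonormal_iff_ite.1 e.orthonormal i j
    simp only [K, sub_apply, _root_.sum_apply, inner_sub_right,
      inner_sum, ContinuousLinearMap.comp_apply, ContinuousLinearMap.smulRight_apply,
      inner_smul_right, this, mul_ite, mul_one, mul_zero, sum_ite_eq, innerSL_apply_apply]
    split_ifs <;> simp
  refine abs_le_of_sq_le_sq' ?_ (by positivity) |>.2
  have htail : 0 ≤ ∑' i, ‖B (e i)‖ ^ 2 - ∑ i ∈ F, ‖B (e i)‖ ^ 2 :=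
    sub_nonneg.2 (hs.sum_le_tsum F fun _ _ => sq_nonneg _)
  rw [mul_pow, Real.sq_sqrt htail]
  have hsum : HasSum (fun i => if i ∈ F then 0 else ‖B (e i)‖ ^ 2)
      (∑' i, ‖B (e i)‖ ^ 2 - ∑ i ∈ F, ‖B (e i)‖ ^ 2) := by
    have h2 := hs.hasSum.sub (hasSum_sum_of_ne_finset_zero
        (f := fun i => if i ∈ F then ‖B (e i)‖ ^ 2 else 0) (s := F)
      (fun i hi => by simp [hi]))
    rw [sum_congr rfl (fun i hi => by rw [if_pos hi])] at h2
    refine h2.congr_fun fun i => ?_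
    split_ifs <;> simp
  refine hasSum_le (fun i => ?_) (hasSum_norm_inner_sq e ((K F - B) x)) (hsum.mul_right _)
  rw [hin]
  split_ifs
  · simp
  · rw [norm_neg, ← hB.isSymmetric.apply_clm (e i) x, ← mul_pow]
    gcongr
    exact norm_inner_le_norm _ _

end HilbertSchmidt

section SpanProj

open Filter Topology

variable {H : Type*} [NormedAddCommGroup H] [InnerProductSpace ℂ H]

/-- The orthogonal projection onto the span of a finite set of vectors. -/
noncomputable def spanProj (F : Finset H) : H →L[ℂ] H :=
  (Submodule.span ℂ (F : Set H)).starProjection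

lemma tendsto_spanProj (x : H) : Tendsto (fun F : Finset H => spanProj F x) atTop (𝓝 x) := by
  refine Submodule.starProjection_tendsto_self _
    (fun F G h => Submodule.span_mono (by exact_mod_cast h)) x ?_
  refine le_trans (fun y _ => ?_) (Submodule.le_topologicalClosure _)
  exact Submodule.mem_iSup_of_mem ({y} : Finset H) (Submodule.subset_span (by simp))

lemma norm_spanProj_apply_le (F : Finset H) (x : H) : ‖spanProj F x‖ ≤ ‖x‖ :=
  Submodule.norm_starProjection_apply_le _ x

lemma tendsto_spanProj_apply {l : Filter (Finset H)} (hl : l ≤ atTop) {x : Finset H → H} {y : H}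
    (hx : Tendsto x l (𝓝 y)) : Tendsto (fun F => spanProj F (x F)) l (𝓝 y) := by
  have h1 : Tendsto (fun F => spanProj F (x F - y)) l (𝓝 0) := by
    refine squeeze_zero_norm (fun F => norm_spanProj_apply_le F _) ?_
    simpa using (hx.sub_const y).norm
  simpa using h1.add ((tendsto_spanProj y).mono_left hl)

lemma spanProj_of_mem {F : Finset H} {x : H} (hx : x ∈ Submodule.span ℂ (F : Set H)) :
    spanProj F x = x :=
  Submodule.starProjection_eq_self_iff.2 hx

lemma isCompactOperator_spanProj (F : Finset H) : IsCompactOperator (spanProj F) := by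
  have : ProperSpace (Submodule.span ℂ (F : Set H)) := FiniteDimensional.proper ℂ _
  exact (isCompactOperator_of_locallyCompactSpace_dom
    (Submodule.span ℂ (F : Set H)).orthogonalProjectionOnto).clm_comp
    (Submodule.span ℂ (F : Set H)).subtypeL

variable [CompleteSpace H]

lemma isSelfAdjoint_spanProj (F : Finset H) : IsSelfAdjoint (spanProj F) :=
  isSelfAdjoint_starProjection _

lemma abs_im_mul_norm_le {T : H →L[ℂ] H} (hT : IsSelfAdjoint T) (μ : ℂ) (x : H) :
    |μ.im| * ‖x‖ ≤ ‖T x - μ • x‖ := by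
  rcases eq_or_ne x 0 with rfl | hx
  · simp
  have h1 : (inner ℂ x (T x - μ • x)).im = -(μ.im * ‖x‖ ^ 2) := by
    have h2 : (inner ℂ x (T x)).im = 0 := by
      rw [← Complex.conj_eq_iff_im, inner_conj_symm]
      exact hT.isSymmetric x x
    rw [inner_sub_right, inner_smul_right, inner_self_eq_norm_sq_to_K, Complex.sub_im, h2]
    simp [Complex.mul_im, ← Complex.ofReal_pow]
  have h3 := (Complex.abs_im_le_norm _).trans (norm_inner_le_norm (𝕜 := ℂ) x (T x - μ • x))
  rw [h1, abs_neg, abs_mul, abs_of_nonneg (sq_nonneg ‖x‖)] at h3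
  have := norm_pos_iff.2 hx
  nlinarith

/-- Compressions of `L + iB`, with `B` compact, have asymptotically real spectrum unless `L + iB`
has an eigenvector. -/
lemma eventually_abs_im_lt {L B A : H →L[ℂ] H} (hL : IsSelfAdjoint L) (hB : IsCompactOperator B)
    (hA : A = L + Complex.I • B) (hev : ∀ (x : H) (μ : ℂ), A x = μ • x → x = 0) {ε : ℝ}
    (hε : 0 < ε) : ∀ᶠ F : Finset H in atTop, ∀ x ∈ Submodule.span ℂ (F : Set H), ∀ μ : ℂ,
      x ≠ 0 → spanProj F (A x) = μ • x → |μ.im| < ε := by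
  by_contra hcon
  rw [not_eventually] at hcon
  set S : Set (Finset H) := {F | ¬ ∀ x ∈ Submodule.span ℂ (F : Set H), ∀ μ : ℂ,
      x ≠ 0 → spanProj F (A x) = μ • x → |μ.im| < ε} with hS
  have hdata : ∀ F : Finset H, ∃ (x : H) (μ : ℂ), F ∈ S → (x ∈ Submodule.span ℂ (F : Set H) ∧
      ‖x‖ = 1 ∧ spanProj F (A x) = μ • x ∧ ε ≤ |μ.im|) := by
    intro F
    by_cases hF : F ∈ S
    · have hF' := hF
      simp only [hS, Set.mem_ofPred_eq] at hF'
      push Not at hF'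
      obtain ⟨x, hx, μ, hx0, hxμ, hμ⟩ := hF'
      refine ⟨((‖x‖⁻¹ : ℝ) : ℂ) • x, μ, fun _ => ⟨Submodule.smul_mem _ _ hx, ?_, ?_, hμ⟩⟩
      · have := norm_ne_zero_iff.2 hx0
        simp [norm_smul, this]
      · rw [map_smul, map_smul, hxμ, smul_comm]
    · exact ⟨0, 0, fun h => absurd h hF⟩
  choose x μ hxμ using hdata
  have hne : (atTop ⊓ 𝓟 S).NeBot := frequently_mem_iff_neBot.1 hcon
  let U : Ultrafilter (Finset H) := Ultrafilter.of (atTop ⊓ 𝓟 S)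
  have hU : (U : Filter (Finset H)) ≤ atTop ⊓ 𝓟 S := Ultrafilter.of_le _
  have hUtop : (U : Filter (Finset H)) ≤ atTop := hU.trans inf_le_left
  have hUS : ∀ᶠ F in (U : Filter (Finset H)), F ∈ S := hU.trans inf_le_right (mem_principal_self S)
  have hx1 : ∀ᶠ F in (U : Filter (Finset H)), ‖x F‖ = 1 := hUS.mono fun F hF => (hxμ F hF).2.1
  obtain ⟨ν, -, hν⟩ : ∃ ν ∈ Metric.closedBall (0 : ℂ) ‖A‖, Tendsto μ U (𝓝 ν) := by
    refine (isCompact_closedBall (0 : ℂ) ‖A‖).ultrafilter_le_nhds (U.map μ) ?_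
    rw [le_principal_iff]
    refine hUS.mono fun F hF => ?_
    obtain ⟨-, h1, h2, -⟩ := hxμ F hF
    have h3 := (norm_spanProj_apply_le F (A (x F))).trans (A.le_opNorm _)
    rw [h2, norm_smul, h1] at h3
    simpa using h3
  obtain ⟨K, hK, hBK⟩ := hB.image_closedBall_subset_compact (f := (B : H →ₗ[ℂ] H)) 1
  obtain ⟨y, -, hy⟩ : ∃ y ∈ K, Tendsto (fun F => B (x F)) U (𝓝 y) := by
    refine hK.ultrafilter_le_nhds (U.map fun F => B (x F)) ?_
    rw [le_principal_iff]
    exact hx1.mono fun F hF => hBK ⟨x F, by simp [hF], rfl⟩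
  have hνε : ε ≤ |ν.im| :=
    ge_of_tendsto ((Complex.continuous_im.tendsto ν).comp hν).abs
      (hUS.mono fun F hF => (hxμ F hF).2.2.2)
  obtain ⟨z, hz⟩ : ∃ z, L z - ν • z = -(Complex.I • y) := by
    have hν' : ν ∉ spectrum ℂ L := fun h => by
      have := congrArg Complex.im (hL.mem_spectrum_eq_re h)
      rw [Complex.ofReal_im] at this
      rw [this, abs_zero] at hνε
      linarith
    rw [spectrum.notMem_iff] at hν'
    obtain ⟨u, hu⟩ := hν'
    have h1 : (u * ↑u⁻¹ : H →L[ℂ] H) (Complex.I • y) = Complex.I • y := by simp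
    refine ⟨(↑u⁻¹ : H →L[ℂ] H) (Complex.I • y), ?_⟩
    rw [hu, mul_apply_eq_comp] at h1
    generalize (↑u⁻¹ : H →L[ℂ] H) (Complex.I • y) = w at h1 ⊢
    rw [← h1]
    simp [Algebra.algebraMap_eq_smul_one]
  have hlim1 : Tendsto (fun F => -(Complex.I • spanProj F (B (x F))) -
      (spanProj F (L (spanProj F z)) - μ F • z)) U (𝓝 0) := by
    have h1 := ((tendsto_spanProj_apply hUtop hy).const_smul Complex.I).neg
    have h2 := tendsto_spanProj_apply hUtop
      ((L.continuous.tendsto z).comp ((tendsto_spanProj z).mono_left hUtop))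
    have h3 := h1.sub (h2.sub (hν.smul_const z))
    rwa [hz, sub_self] at h3
  have hxz : Tendsto x U (𝓝 z) := by
    rw [tendsto_iff_norm_sub_tendsto_zero]
    have hlim2 := hlim1.norm.const_mul ε⁻¹
    rw [norm_zero, mul_zero] at hlim2
    refine squeeze_zero' (Eventually.of_forall fun _ => norm_nonneg _) (hUS.mono fun F hF => ?_)
      hlim2
    obtain ⟨h0, h1, h2, h3⟩ := hxμ F hF
    have hself : IsSelfAdjoint (spanProj F ∘L L ∘L spanProj F) := by
      have := hL.conjugate (spanProj F)
      rwa [(isSelfAdjoint_spanProj F).star_eq, mul_assoc] at this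
    have h4 := abs_im_mul_norm_le hself (μ F) (x F - z)
    have h5 : (spanProj F ∘L L ∘L spanProj F) (x F - z) - μ F • (x F - z) =
        -(Complex.I • spanProj F (B (x F))) - (spanProj F (L (spanProj F z)) - μ F • z) := by
      rw [hA] at h2
      simp only [ContinuousLinearMap.comp_apply, map_sub, spanProj_of_mem h0, add_apply,
        smul_apply, map_add, map_smul] at h2 ⊢
      rw [smul_sub, ← h2]
      abel
    rw [h5] at h4
    rw [le_inv_mul_iff₀ hε]
    exact (mul_le_mul_of_nonneg_right h3 (norm_nonneg _)).trans h4
  have hz1 : ‖z‖ = 1 :=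
    tendsto_nhds_unique hxz.norm (tendsto_const_nhds.congr' (hx1.mono fun F hF => hF.symm))
  have hAz : A z = ν • z := by
    refine tendsto_nhds_unique (tendsto_spanProj_apply hUtop ((A.continuous.tendsto z).comp hxz)) ?_
    exact (hν.smul hxz).congr' (hUS.mono fun F hF => (hxμ F hF).2.2.1.symm)
  simp [hev z ν hAz] at hz1

end SpanProj

section HilbertSchmidtBound

variable {H : Type*} [NormedAddCommGroup H] [InnerProductSpace ℂ H] [CompleteSpace H] {ι : Type*}

lemma sum_norm_inner_sub_conj_sq_le {L B A : H →L[ℂ] H} (hL : IsSelfAdjoint L)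
    (hB : IsSelfAdjoint B) (hA : A = L + Complex.I • B)
    (e : HilbertBasis ι ℂ H) (hs : Summable fun i => ‖B (e i)‖ ^ 2) {n : ℕ} {b : Fin n → H}
    (hb : Orthonormal ℂ b) :
    ∑ i, ∑ j, ‖inner ℂ (b i) (A (b j)) - starRingEnd ℂ (inner ℂ (b j) (A (b i)))‖ ^ 2 ≤
      (2 * √(∑' i, ‖B (e i)‖ ^ 2)) ^ 2 := by
  have h1 : ∀ i j, inner ℂ (b i) (A (b j)) - starRingEnd ℂ (inner ℂ (b j) (A (b i))) =
      2 * Complex.I * inner ℂ (b i) (B (b j)) := fun i j => by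
    have h2 := hL.isSymmetric.apply_clm (b i) (b j)
    have h3 := hB.isSymmetric.apply_clm (b i) (b j)
    rw [inner_conj_symm, hA]
    simp only [add_apply, smul_apply, inner_add_left, inner_add_right, inner_smul_left,
      inner_smul_right, h2, h3, Complex.conj_I]
    ring
  have h4 : ∀ j, ∑ i, ‖inner ℂ (b i) (B (b j))‖ ^ 2 ≤ ‖B (b j)‖ ^ 2 := fun j =>
    hb.sum_inner_products_le _
  rw [sum_comm, mul_pow, Real.sq_sqrt (tsum_nonneg fun _ => sq_nonneg _)]
  refine le_trans ?_ (mul_le_mul_of_nonneg_left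
    ((sum_le_sum fun j _ => h4 j).trans (sum_norm_apply_orthonormal_sq_le hB e hs hb))
    (by norm_num))
  simp only [h1, mul_sum, norm_mul, mul_pow]
  simp

end HilbertSchmidtBound

section PowerBound

open Filter Topology

variable {H : Type*} [NormedAddCommGroup H] [InnerProductSpace ℂ H]

/-- The compression of an operator to the span of a finite set. -/
noncomputable def compression (A : H →L[ℂ] H) (F : Finset H) :
    Module.End ℂ (Submodule.span ℂ (F : Set H)) :=
  ((Submodule.span ℂ (F : Set H)).orthogonalProjectionOnto ∘L A ∘L
    (Submodule.span ℂ (F : Set H)).subtypeL : _ →L[ℂ] _)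

lemma coe_compression_apply (A : H →L[ℂ] H) (F : Finset H) (x) :
    (compression A F x : H) = spanProj F (A x) := rfl

lemma tendsto_compression_pow (A : H →L[ℂ] H) (a b : ℂ) (m : ℕ) (x : H) :
    Tendsto (fun F : Finset H => (((algebraMap ℂ (Module.End ℂ (Submodule.span ℂ (F : Set H))) a +
      b • compression A F) ^ m) ((Submodule.span ℂ (F : Set H)).orthogonalProjectionOnto x) : H))
      atTop (𝓝 (((algebraMap ℂ (H →L[ℂ] H) a + b • A) ^ m) x)) := by
  induction m with
  | zero => exact tendsto_spanProj x
  | succ m ih =>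
    have h1 := (ih.const_smul a).add
      ((tendsto_spanProj_apply le_rfl ((A.continuous.tendsto _).comp ih)).const_smul b)
    simp only [pow_succ']
    convert h1 using 2
    · simp [Module.algebraMap_end_apply, coe_compression_apply]
    · simp [Algebra.algebraMap_eq_smul_one]

lemma norm_add_smul_pow_le {A : H →L[ℂ] H} {c : ℝ} (hc : 0 ≤ c)
    (hHS : ∀ (n : ℕ) (b : Fin n → H), Orthonormal ℂ b →
      ∑ i, ∑ j, ‖inner ℂ (b i) (A (b j)) - starRingEnd ℂ (inner ℂ (b j) (A (b i)))‖ ^ 2 ≤ c ^ 2)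
    (him : ∀ ε : ℝ, 0 < ε → ∀ᶠ F : Finset H in atTop, ∀ x ∈ Submodule.span ℂ (F : Set H),
      ∀ μ : ℂ, x ≠ 0 → spanProj F (A x) = μ • x → |μ.im| < ε) (s t : ℝ) (m : ℕ) :
    ‖(algebraMap ℂ (H →L[ℂ] H) s + ((t : ℂ) * Complex.I) • A) ^ m‖ ≤
      ∑ k ∈ range (m + 1), m.choose k * √(s ^ 2 + t ^ 2 * ‖A‖ ^ 2) ^ (m - k) *
        ((|t| * c) ^ k / √k.factorial) := by
  refine ContinuousLinearMap.opNorm_le_bound _ (by positivity) fun x => ?_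
  let g : ℝ → ℝ := fun ε => (∑ k ∈ range (m + 1), m.choose k *
    √((|s| + |t| * ε) ^ 2 + t ^ 2 * ‖A‖ ^ 2) ^ (m - k) * ((|t| * c) ^ k / √k.factorial)) * ‖x‖
  have hg : Continuous g := by fun_prop
  have hg0 : g 0 = (∑ k ∈ range (m + 1), m.choose k * √(s ^ 2 + t ^ 2 * ‖A‖ ^ 2) ^ (m - k) *
        ((|t| * c) ^ k / √k.factorial)) * ‖x‖ := by simp [g]
  rw [← hg0]
  refine ge_of_tendsto ((hg.tendsto 0).mono_left (nhdsWithin_le_nhds (s := Set.Ioi 0))) ?_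
  filter_upwards [self_mem_nhdsWithin] with ε hε
  refine le_of_tendsto (tendsto_compression_pow A s (t * Complex.I) m x).norm ?_
  filter_upwards [him ε hε] with F hF
  have hfin := norm_add_mul_I_smul_pow_le (compression A F) (ε := ε) (R := ‖A‖) hc
    (fun μ hμ => ?_) (fun b hb => ?_) s t m
    ((Submodule.span ℂ (F : Set H)).orthogonalProjectionOnto x)
  · refine hfin.trans (mul_le_mul_of_nonneg_left ?_ (by positivity))
    exact norm_spanProj_apply_le F x
  · obtain ⟨v, hv⟩ := hμ.exists_hasEigenvector
    have hv1 : spanProj F (A v) = μ • (v : H) := by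
      rw [← coe_compression_apply, hv.apply_eq_smul]; rfl
    have hv0 : (v : H) ≠ 0 := by simpa using hv.2
    refine ⟨(hF v v.2 μ hv0 hv1).le, (Complex.abs_re_le_norm μ).trans ?_⟩
    have h2 := (norm_spanProj_apply_le F (A v)).trans (A.le_opNorm v)
    rw [hv1, norm_smul] at h2
    exact le_of_mul_le_mul_right h2 (norm_pos_iff.2 hv0)
  · have hb' : Orthonormal ℂ (fun i => (b i : H)) := hb.comp_linearIsometry
      (Submodule.span ℂ (F : Set H)).subtypeₗᵢ
    refine le_trans (le_of_eq ?_) (hHS _ _ hb')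
    have h3 : ∀ i j, inner ℂ (b i) (compression A F (b j)) = inner ℂ (b i : H) (A (b j)) :=
      fun i j => by
        rw [Submodule.coe_inner, coe_compression_apply]
        exact (Submodule.inner_starProjection_left_eq_right _ _ _).symm.trans
          (by rw [Submodule.starProjection_eq_self_iff.2 (b i).2])
    simp only [h3]

end PowerBound

section GrowthSeries

open Filter Topology

/-- The entire function `∑ xᵏ / (k!)^{3/2}`, of order `2/3`. -/
noncomputable def growthSeries (x : ℝ) : ℝ := ∑' k : ℕ, x ^ k / (k.factorial * √k.factorial)

lemma summable_growthSeries (x : ℝ) :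
    Summable fun k : ℕ => x ^ k / ((k.factorial : ℝ) * √k.factorial) := by
  refine Summable.of_norm_bounded (Real.summable_pow_div_factorial |x|) fun k => ?_
  have h1 : (1 : ℝ) ≤ k.factorial := by exact_mod_cast Nat.one_le_iff_ne_zero.2 k.factorial_ne_zero
  rw [norm_div, norm_pow, Real.norm_eq_abs, Real.norm_of_nonneg (by positivity)]
  gcongr
  exact le_mul_of_one_le_right (by positivity) (Real.one_le_sqrt.2 h1)

lemma norm_exp_le_exp_mul_growthSeries {𝔸 : Type*} [NormedRing 𝔸] [NormedAlgebra ℂ 𝔸]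
    [CompleteSpace 𝔸] {Y : 𝔸} {ρ x : ℝ}
    (h : ∀ m, ‖Y ^ m‖ ≤ ∑ k ∈ range (m + 1), m.choose k * ρ ^ (m - k) * (x ^ k / √k.factorial)) :
    ‖NormedSpace.exp Y‖ ≤ Real.exp ρ * growthSeries x := by
  have hs1 := Real.summable_pow_div_factorial ρ
  have hs2 := summable_growthSeries x
  have hprod := (summable_norm_sum_mul_range_of_summable_norm hs2.norm hs1.norm).of_norm
  have heq := tsum_mul_tsum_eq_tsum_sum_range_of_summable_norm hs2.norm hs1.norm
  have hbd : ∀ m : ℕ, ‖((m.factorial : ℂ)⁻¹) • Y ^ m‖ ≤ ∑ k ∈ range (m + 1),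
      x ^ k / ((k.factorial : ℝ) * √k.factorial) * (ρ ^ (m - k) / (m - k).factorial) := fun m => by
    rw [norm_smul, norm_inv, Complex.norm_natCast]
    refine (mul_le_mul_of_nonneg_left (h m) (by positivity)).trans (le_of_eq ?_)
    rw [mul_sum]
    refine sum_congr rfl fun k hk => ?_
    rw [Nat.cast_choose ℝ (Nat.lt_succ_iff.1 (mem_range.1 hk))]
    field_simp
  have hexp : Real.exp ρ = ∑' n : ℕ, ρ ^ n / n.factorial := by
    rw [Real.exp_eq_exp_ℝ, NormedSpace.exp_eq_tsum_div]
  rw [mul_comm, hexp, growthSeries, heq, NormedSpace.exp_eq_tsum ℂ]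
  exact tsum_of_norm_bounded hprod.hasSum hbd

lemma norm_exp_le_growthSeries {𝔸 : Type*} [NormedRing 𝔸] [NormedAlgebra ℂ 𝔸]
    [CompleteSpace 𝔸] {X : 𝔸} {q x : ℝ} (hq : 0 ≤ q) (hx : 0 ≤ x)
    (h : ∀ (s : ℝ) (m : ℕ), ‖(algebraMap ℂ 𝔸 s + X) ^ m‖ ≤ ∑ k ∈ range (m + 1),
      m.choose k * √(s ^ 2 + q) ^ (m - k) * (x ^ k / √k.factorial)) :
    ‖NormedSpace.exp X‖ ≤ growthSeries x := by
  have hlim : Tendsto (fun s : ℝ => Real.exp (q / s) * growthSeries x) atTop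
      (𝓝 (growthSeries x)) := by
    have h1 : Tendsto (fun s : ℝ => q / s) atTop (𝓝 0) := tendsto_id.const_div_atTop q
    simpa using ((Real.continuous_exp.tendsto 0).comp h1).mul_const (growthSeries x)
  refine ge_of_tendsto hlim ?_
  filter_upwards [eventually_gt_atTop 0] with s hs
  have h1 := norm_exp_le_exp_mul_growthSeries (h s)
  have h2 : NormedSpace.exp (algebraMap ℂ 𝔸 s + X) = Complex.exp s • NormedSpace.exp X := by
    let := NormedAlgebra.restrictScalars ℚ ℂ 𝔸
    rw [NormedSpace.exp_add_of_commute (Algebra.commutes _ _), ← NormedSpace.algebraMap_exp_comm,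
      ← Algebra.smul_def, Complex.exp_eq_exp_ℂ]
  have hM : 0 ≤ growthSeries x := tsum_nonneg fun _ => by positivity
  have h3 : √(s ^ 2 + q) ≤ s + q / s := by
    rw [Real.sqrt_le_left (by positivity)]
    have : (s + q / s) ^ 2 = s ^ 2 + 2 * q + (q / s) ^ 2 := by field_simp; ring
    nlinarith [sq_nonneg (q / s)]
  have h4 := h1.trans (mul_le_mul_of_nonneg_right (Real.exp_le_exp.2 h3) hM)
  rw [h2, norm_smul, Complex.norm_exp_ofReal, Real.exp_add, mul_assoc] at h4
  exact le_of_mul_le_mul_left h4 (Real.exp_pos s)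

end GrowthSeries

section BumpCoefficients

open Filter Topology Real

lemma abs_sinc_le_inv_abs {x : ℝ} (hx : x ≠ 0) : |sinc x| ≤ |x|⁻¹ := by
  rw [sinc_of_ne_zero hx, abs_div, div_eq_mul_inv]
  exact mul_le_of_le_one_left (by positivity) (abs_sin_le_one x)

lemma summable_sinc_sq {b : ℝ} (hb : 0 < b) : Summable fun n : ℤ => sinc (b * n) ^ 2 := by
  have h1 := ((Real.summable_one_div_int_pow (p := 2)).2 one_lt_two).mul_left (b ^ 2)⁻¹
  have h2 : Summable fun n : ℤ => if n = 0 then (1 : ℝ) else 0 :=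
    (hasSum_ite_eq (0 : ℤ) (1 : ℝ)).summable
  refine Summable.of_nonneg_of_le (fun _ => sq_nonneg _) (fun n => ?_) (h1.add h2)
  rcases eq_or_ne n 0 with rfl | hn
  · simp
  · have h3 := abs_sinc_le_inv_abs (x := b * n) (by positivity)
    rw [← sq_abs, if_neg hn, add_zero]
    refine (pow_le_pow_left₀ (abs_nonneg _) h3 2).trans (le_of_eq ?_)
    rw [inv_pow, sq_abs, mul_pow, mul_inv, one_div]

lemma hasSum_cos_div_sq {θ : ℝ} (h0 : 0 ≤ θ) (h1 : θ ≤ 2 * π) :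
    HasSum (fun n : ℕ => cos (n * θ) / (n : ℝ) ^ 2) (θ ^ 2 / 4 - π * θ / 2 + π ^ 2 / 6) := by
  have hπ := Real.pi_pos
  have h := hasSum_one_div_nat_pow_mul_cos one_ne_zero (x := θ / (2 * π))
    ⟨by positivity, (div_le_one (by positivity)).2 h1⟩
  have h2 := bernoulliFun_two (θ / (2 * π))
  rw [bernoulliFun] at h2
  convert h using 1
  · ext n
    rw [mul_one, one_div_mul_eq_div]
    congr 2
    field_simp
  · rw [mul_one, h2]
    norm_num
    field_simp
    ring

lemma tsum_sinc_sq_mul_exp_eq_zero {b θ : ℝ} (hb : 0 < b) (h1 : 2 * b ≤ θ)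
    (h2 : θ ≤ 2 * π - 2 * b) :
    ∑' n : ℤ, ((sinc (b * n) ^ 2 : ℝ) : ℂ) * Complex.exp (n * θ * Complex.I) = 0 := by
  set f : ℤ → ℂ := fun n => ((sinc (b * n) ^ 2 : ℝ) : ℂ) * Complex.exp (n * θ * Complex.I) with hf
  have hsf : Summable f := by
    refine Summable.of_norm_bounded (summable_sinc_sq hb) fun n => le_of_eq ?_
    have : ((n : ℂ) * θ * Complex.I) = ((n * θ : ℝ) : ℂ) * Complex.I := by push_cast; ring
    rw [hf, norm_mul, this, Complex.norm_exp_ofReal_mul_I, mul_one, Complex.norm_real,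
      norm_of_nonneg (sq_nonneg _)]
  have hnat := hsf.hasSum.nat_add_neg
  have hG := (((hasSum_cos_div_sq (by linarith) (by linarith : θ ≤ 2 * π)).sub
    ((hasSum_cos_div_sq (by linarith : 0 ≤ θ + 2 * b) (by linarith)).mul_left (1 / 2))).sub
    ((hasSum_cos_div_sq (by linarith : 0 ≤ θ - 2 * b) (by linarith)).mul_left
      (1 / 2))).mul_left (b ^ 2)⁻¹
  have hS := (hG.add (hasSum_ite_eq (0 : ℕ) (2 : ℝ)))
  have hS' := Complex.hasSum_ofReal.2 hS
  have heq : ∀ n : ℕ, f n + f (-n) = (((b ^ 2)⁻¹ * (cos (n * θ) / (n : ℝ) ^ 2 -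
      1 / 2 * (cos (n * (θ + 2 * b)) / (n : ℝ) ^ 2) -
        1 / 2 * (cos (n * (θ - 2 * b)) / (n : ℝ) ^ 2)) +
      if n = 0 then (2 : ℝ) else 0 : ℝ) : ℂ) := fun n => by
    have h3 : f n + f (-n) = ((2 * sinc (b * n) ^ 2 * cos (n * θ) : ℝ) : ℂ) := by
      simp only [hf]
      push_cast
      rw [mul_neg, sinc_neg, Complex.cos]
      ring_nf
    rw [h3]
    congr 1
    rcases eq_or_ne n 0 with rfl | hn
    · simp
    · have : (n : ℝ) ≠ 0 := by exact_mod_cast hn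
      rw [sinc_of_ne_zero (by positivity), if_neg hn, add_zero, mul_add,
        mul_sub (n : ℝ), cos_add, cos_sub,
        show (n : ℝ) * (2 * b) = 2 * (b * n) by ring, cos_two_mul', cos_sq']
      field_simp
      ring
  have h4 := (hnat.congr_fun fun n => (heq n).symm).unique hS'
  have hf0 : f 0 = 1 := by simp [hf]
  rw [hf0] at h4
  have h5 : ((b ^ 2)⁻¹ * (θ ^ 2 / 4 - π * θ / 2 + π ^ 2 / 6 -
      1 / 2 * ((θ + 2 * b) ^ 2 / 4 - π * (θ + 2 * b) / 2 + π ^ 2 / 6) -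
      1 / 2 * ((θ - 2 * b) ^ 2 / 4 - π * (θ - 2 * b) / 2 + π ^ 2 / 6)) + 2) = 1 := by
    field_simp
    ring
  rw [h5] at h4
  simpa using h4

lemma tsum_mul_sinc_mul_exp_eq_zero {c : ℤ → ℂ} (hc : Summable c) {a α β : ℝ} (ha : 0 < a)
    (h : ∀ θ ∈ Set.Icc α β, ∑' n : ℤ, c n * Complex.exp (n * θ * Complex.I) = 0) :
    ∀ θ ∈ Set.Icc (α + a) (β - a),
      ∑' n : ℤ, c n * (sinc (a * n) : ℂ) * Complex.exp (n * θ * Complex.I) = 0 := by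
  intro θ hθ
  let f : ℤ → C(ℝ, ℂ) := fun n =>
    ⟨fun u => c n * Complex.exp (n * ((θ + u : ℝ) : ℂ) * Complex.I), by fun_prop⟩
  have hsum := intervalIntegral.tsum_intervalIntegral_eq_of_summable_norm (f := f)
      (a := -a) (b := a)
    (Summable.of_nonneg_of_le (fun _ => norm_nonneg _) (fun n => by
      refine (ContinuousMap.norm_le _ (norm_nonneg (c n))).2 fun u => le_of_eq ?_
      simp only [f, ContinuousMap.restrict_apply, ContinuousMap.coe_mk]
      have : ((n : ℂ) * ((θ + u : ℝ) : ℂ) * Complex.I) =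
        ((n * (θ + u) : ℝ) : ℂ) * Complex.I := by push_cast; ring
      rw [norm_mul, this, Complex.norm_exp_ofReal_mul_I, mul_one]) hc.norm)
  have h0 : ∫ u in (-a)..a, ∑' n, f n u = 0 := by
    rw [intervalIntegral.integral_congr (g := fun _ => (0 : ℂ)) fun u hu => ?_]
    · simp
    · rw [Set.uIcc_of_le (by linarith)] at hu
      exact h (θ + u) ⟨by linarith [hθ.1, hu.1], by linarith [hθ.2, hu.2]⟩
  have h1 : ∀ n : ℤ, ∫ u in (-a)..a, f n u =
      2 * a * (c n * (sinc (a * n) : ℂ) * Complex.exp (n * θ * Complex.I)) := fun n => by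
    have h2 : ∀ u : ℝ, f n u = (c n * Complex.exp (n * θ * Complex.I)) *
        Complex.exp (((n * u : ℝ) : ℂ) * Complex.I) := fun u => by
      simp only [f, ContinuousMap.coe_mk]
      rw [mul_assoc (c n), ← Complex.exp_add]
      push_cast
      ring_nf
    simp only [h2]
    rw [intervalIntegral.integral_const_mul]
    rcases eq_or_ne n 0 with rfl | hn
    · simp
      ring
    · have hn' : (n : ℝ) ≠ 0 := by exact_mod_cast hn
      have h3 := intervalIntegral.integral_comp_mul_left
        (fun v : ℝ => Complex.exp ((v : ℂ) * Complex.I)) hn' (a := -a) (b := a)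
      rw [h3, mul_neg, integral_exp_mul_I_eq_sinc, mul_comm (n : ℝ) a, Complex.real_smul]
      have hn'' : (n : ℂ) ≠ 0 := by exact_mod_cast hn
      push_cast
      field_simp
  simp only [h0, h1, tsum_mul_left] at hsum
  have ha' : (2 * a : ℂ) ≠ 0 := by exact_mod_cast (by positivity : (2 * a : ℝ) ≠ 0)
  exact (mul_eq_zero.1 hsum).resolve_left ha'

lemma eq_zero_of_tsum_mul_exp_eq_zero {c : ℤ → ℂ} (hc : Summable c)
    (h : ∀ θ : ℝ, ∑' n : ℤ, c n * Complex.exp (n * θ * Complex.I) = 0) (k : ℤ) : c k = 0 := by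
  have h1 := tsum_mul_sinc_mul_exp_eq_zero (c := fun n => c (n + k)) (α := -π) (β := π)
    (hc.comp_injective (add_left_injective k)) pi_pos
    (fun θ _ => by
      have h2 : ∀ n : ℤ, c (n + k) * Complex.exp (n * θ * Complex.I) =
          Complex.exp (-(k * θ * Complex.I)) *
            (c (n + k) * Complex.exp ((n + k : ℤ) * θ * Complex.I)) := fun n => by
        rw [mul_left_comm, ← Complex.exp_add]
        push_cast
        ring_nf
      simp only [h2, tsum_mul_left]
      have h3 := (Equiv.addRight k).tsum_eq fun n : ℤ => c n * Complex.exp (n * θ * Complex.I)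
      simp only [Equiv.coe_addRight] at h3
      rw [h3, h, mul_zero]) 0 (by simp)
  rw [tsum_eq_single 0 fun n hn => ?_] at h1
  · simpa using h1
  · have hn' : (n : ℝ) ≠ 0 := by exact_mod_cast hn
    rw [sinc_of_ne_zero (by positivity), mul_comm π, sin_int_mul_pi]
    simp

lemma growthSeries_nonneg {x : ℝ} (hx : 0 ≤ x) : 0 ≤ growthSeries x :=
  tsum_nonneg fun _ => by positivity

lemma summable_prod_inv_mul_growthSeries_coeff {a : ℕ → ℝ} (ha : ∀ j, 0 < a j)
    (hlim : Tendsto (fun k : ℕ => (a (k + 2) * ((k + 1) * √(k + 1)))⁻¹) atTop (𝓝 0)) {K : ℝ}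
    (hK : 0 < K) :
    Summable fun k : ℕ => (∏ j ∈ range (k + 2), (a j)⁻¹) *
      (K ^ k / ((k.factorial : ℝ) * √k.factorial)) := by
  have hpos : ∀ k : ℕ, 0 < (∏ j ∈ range (k + 2), (a j)⁻¹) *
      (K ^ k / ((k.factorial : ℝ) * √k.factorial)) := fun k => by
    have := prod_pos fun j (_ : j ∈ range (k + 2)) => inv_pos.2 (ha j)
    positivity
  refine summable_of_ratio_test_tendsto_lt_one (l := 0) one_pos
    (Eventually.of_forall fun k => (hpos k).ne') ?_
  have h1 := hlim.mul_const K
  rw [zero_mul] at h1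
  refine h1.congr fun k => ?_
  rw [norm_of_nonneg (hpos _).le, norm_of_nonneg (hpos _).le, eq_div_iff (hpos k).ne',
    prod_range_succ _ (k + 2), Nat.factorial_succ, Nat.cast_mul, sqrt_mul (by positivity), pow_succ]
  push_cast
  have := ha (k + 2)
  field_simp

lemma abs_mul_growthSeries_le {a : ℕ → ℝ} (ha : ∀ j, 0 < a j)
    (hlim : Tendsto (fun k : ℕ => (a (k + 2) * ((k + 1) * √(k + 1)))⁻¹) atTop (𝓝 0)) {K : ℝ}
    (hK : 0 < K) {c : ℝ} {n : ℤ} (hn : n ≠ 0)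
    (hc : ∀ m, |c| ≤ ∏ j ∈ range m, (a j * |(n : ℝ)|)⁻¹) :
    |c| * growthSeries (K * |(n : ℝ)|) ≤ (∑' k : ℕ, (∏ j ∈ range (k + 2), (a j)⁻¹) *
      (K ^ k / ((k.factorial : ℝ) * √k.factorial))) * (1 / (n : ℝ) ^ 2) := by
  have hs := summable_prod_inv_mul_growthSeries_coeff ha hlim hK
  have hn' : 0 < |(n : ℝ)| := abs_pos.2 (by exact_mod_cast hn)
  rw [growthSeries, ← tsum_mul_left, ← tsum_mul_right]
  refine ((summable_growthSeries _).mul_left _).tsum_le_tsum (fun k => ?_) (hs.mul_right _)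
  refine (mul_le_mul_of_nonneg_right (hc (k + 2)) (by positivity)).trans (le_of_eq ?_)
  simp only [mul_inv, prod_mul_distrib, prod_const, card_range]
  rw [← sq_abs (n : ℝ), mul_pow, inv_pow]
  field_simp
  ring

lemma exists_bump_coeff_of_seq {a : ℕ → ℝ} (ha : ∀ j, 0 < a j)
    (hlim : Tendsto (fun k : ℕ => (a (k + 2) * ((k + 1) * √(k + 1)))⁻¹) atTop (𝓝 0)) {b r : ℝ}
    (hb : 0 < b) (har : ∀ J, 2 * b + ∑ j ∈ range J, a j ≤ r) :
    ∃ c : ℤ → ℝ, c 0 = 1 ∧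
      (∀ K, 0 < K → Summable fun n : ℤ => |c n| * growthSeries (K * |(n : ℝ)|)) ∧
      ∀ θ ∈ Set.Icc r (2 * π - r),
        ∑' n : ℤ, (c n : ℂ) * Complex.exp (n * θ * Complex.I) = 0 := by
  let P : ℕ → ℤ → ℝ := fun J n => ∏ j ∈ range J, sinc (a j * n)
  have hP1 : ∀ J n, |P J n| ≤ 1 := fun J n => by
    rw [abs_prod]
    exact prod_le_one (fun _ _ => abs_nonneg _) fun _ _ => abs_sinc_le_one _
  have hle : ∀ (J : ℕ) (n : ℤ), ‖sinc (b * n) ^ 2 * P J n‖ ≤ sinc (b * n) ^ 2 := fun J n => by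
    rw [norm_mul, norm_of_nonneg (sq_nonneg _)]
    exact mul_le_of_le_one_right (sq_nonneg _) (hP1 J n)
  have hPzero : ∀ J, ∀ θ ∈ Set.Icc (2 * b + ∑ j ∈ range J, a j)
      (2 * π - 2 * b - ∑ j ∈ range J, a j),
      ∑' n : ℤ, ((sinc (b * n) ^ 2 * P J n : ℝ) : ℂ) * Complex.exp (n * θ * Complex.I) = 0 := by
    intro J
    induction J with
    | zero =>
      intro θ hθ
      simp only [range_zero, sum_empty, add_zero, sub_zero] at hθ
      simpa [P] using tsum_sinc_sq_mul_exp_eq_zero hb hθ.1 hθ.2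
    | succ J ih =>
      have h1 := tsum_mul_sinc_mul_exp_eq_zero (Complex.summable_ofReal.2
        (Summable.of_norm_bounded (summable_sinc_sq hb) (hle J))) (ha J) ih
      simpa only [P, prod_range_succ, sum_range_succ, mul_assoc, ← add_assoc, sub_sub,
        Complex.ofReal_mul] using h1
  have hPdecay : ∀ (n : ℤ), n ≠ 0 → ∀ m J, m ≤ J → |P J n| ≤
      ∏ j ∈ range m, (a j * |(n : ℝ)|)⁻¹ := by
    intro n hn m J hmJ
    have hn' : (n : ℝ) ≠ 0 := by exact_mod_cast hn
    rw [abs_prod, ← prod_range_mul_prod_Ico _ hmJ]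
    refine (mul_le_of_le_one_right (prod_nonneg fun _ _ => abs_nonneg _)
      (prod_le_one (fun _ _ => abs_nonneg _) fun _ _ => abs_sinc_le_one _)).trans ?_
    refine prod_le_prod (fun _ _ => abs_nonneg _) fun j _ => ?_
    refine (abs_sinc_le_inv_abs (mul_ne_zero (ha j).ne' hn')).trans (le_of_eq ?_)
    rw [abs_mul, abs_of_pos (ha j)]
  have hex : ∀ n : ℤ, ∃ p ∈ Set.Icc (-1 : ℝ) 1,
      Tendsto (fun J : ℕ => P J n) (hyperfilter ℕ) (𝓝 p) :=
    fun n => isCompact_Icc.ultrafilter_le_nhds ((hyperfilter ℕ).map fun J : ℕ => P J n)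
      (le_principal_iff.2 (mem_map.2 (univ_mem' fun J => abs_le.1 (hP1 J n))))
  choose p hp1 hp using hex
  have hpc : ∀ n : ℤ, |sinc (b * n) ^ 2 * p n| ≤ |p n| := fun n => by
    rw [abs_mul, abs_of_nonneg (sq_nonneg _), ← sq_abs]
    exact mul_le_of_le_one_left (abs_nonneg _) (pow_le_one₀ (abs_nonneg _) (abs_sinc_le_one _))
  refine ⟨fun n => sinc (b * n) ^ 2 * p n, ?_, fun K hK => ?_, fun θ hθ => ?_⟩
  · have h0 : p 0 = 1 := tendsto_nhds_unique (hp 0) (by simp [P])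
    simp [h0]
  · have h1 := ((Real.summable_one_div_int_pow (p := 2)).2 one_lt_two).mul_left
      (∑' k : ℕ, (∏ j ∈ range (k + 2), (a j)⁻¹) * (K ^ k / ((k.factorial : ℝ) * √k.factorial)))
    have h2 : Summable fun n : ℤ => if n = 0 then growthSeries 0 else 0 :=
      (hasSum_ite_eq (0 : ℤ) _).summable
    refine Summable.of_nonneg_of_le
      (fun n => mul_nonneg (abs_nonneg _) (growthSeries_nonneg (by positivity)))
      (fun n => ?_) (h1.add h2)
    refine (mul_le_mul_of_nonneg_right (hpc n) (growthSeries_nonneg (by positivity))).trans ?_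
    rcases eq_or_ne n 0 with rfl | hn
    · simpa using mul_le_of_le_one_left (growthSeries_nonneg le_rfl) (abs_le.2 (hp1 0))
    · rw [if_neg hn, add_zero]
      refine abs_mul_growthSeries_le ha hlim hK hn fun m => ?_
      refine le_of_tendsto (hp n).abs ?_
      exact Nat.hyperfilter_le_atTop ((eventually_ge_atTop m).mono fun J hJ => hPdecay n hn m J hJ)
  · have hdom := tendsto_tsum_of_dominated_convergence (𝓕 := (hyperfilter ℕ : Filter ℕ))
      (f := fun J (n : ℤ) => ((sinc (b * n) ^ 2 * P J n : ℝ) : ℂ) *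
        Complex.exp (n * θ * Complex.I))
      (g := fun n : ℤ => ((sinc (b * n) ^ 2 * p n : ℝ) : ℂ) * Complex.exp (n * θ * Complex.I))
      (summable_sinc_sq hb)
      (fun n => ((Complex.continuous_ofReal.tendsto _).comp
        ((hp n).const_mul _)).mul_const _)
      (Eventually.of_forall fun J n => by
        have : ((n : ℂ) * θ * Complex.I) = ((n * θ : ℝ) : ℂ) * Complex.I := by push_cast; ring
        rw [norm_mul, this, Complex.norm_exp_ofReal_mul_I, mul_one, Complex.norm_real]
        exact hle J n)
    refine tendsto_nhds_unique hdom ?_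
    refine tendsto_const_nhds.congr fun J => (hPzero J θ ⟨?_, ?_⟩).symm
    · linarith [har J, hθ.1]
    · linarith [har J, hθ.2]

lemma exists_bump_coeff {r : ℝ} (hr : 0 < r) :
    ∃ c : ℤ → ℝ, c 0 = 1 ∧
      (∀ K, 0 < K → Summable fun n : ℤ => |c n| * growthSeries (K * |(n : ℝ)|)) ∧
      ∀ θ ∈ Set.Icc r (2 * π - r),
        ∑' n : ℤ, (c n : ℂ) * Complex.exp (n * θ * Complex.I) = 0 := by
  have hsum : Summable fun j : ℕ => ((j : ℝ) + 1) ^ (-(5 / 4) : ℝ) := by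
    have h := (summable_nat_add_iff 1).2
        (Real.summable_nat_rpow.2 (by norm_num : -(5 / 4 : ℝ) < -1))
    exact_mod_cast h
  set S := ∑' j : ℕ, ((j : ℝ) + 1) ^ (-(5 / 4) : ℝ) with hS
  have hS0 : 0 ≤ S := tsum_nonneg fun _ => by positivity
  set δ := r / (2 * (S + 1)) with hδ
  have hδ0 : 0 < δ := by positivity
  refine exists_bump_coeff_of_seq (a := fun j => δ * ((j : ℝ) + 1) ^ (-(5 / 4) : ℝ)) (b := r / 4)
    (fun j => by positivity) ?_ (by positivity) fun J => ?_
  · have h0 : Tendsto (fun k : ℕ => δ⁻¹ * 3 ^ (5 / 4 : ℝ) * ((k : ℝ) + 1) ^ (-(1 / 4) : ℝ)) atTop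
        (𝓝 0) := by
      rw [← mul_zero (δ⁻¹ * 3 ^ (5 / 4 : ℝ))]
      refine Tendsto.const_mul _ ((tendsto_rpow_neg_atTop (by norm_num)).comp ?_)
      exact tendsto_atTop_add_const_right _ _ tendsto_natCast_atTop_atTop
    refine squeeze_zero (fun k => by positivity) (fun k => ?_) h0
    have hk : (0 : ℝ) < (k : ℝ) + 1 := by positivity
    have h1 : ((k : ℝ) + 1) * √((k : ℝ) + 1) = ((k : ℝ) + 1) ^ (3 / 2 : ℝ) := by
      rw [Real.sqrt_eq_rpow, ← Real.rpow_one_add' hk.le (by norm_num)]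
      norm_num
    rw [h1, mul_inv, mul_inv, ← Real.rpow_neg (by positivity), ← Real.rpow_neg (by positivity),
      neg_neg, mul_assoc, mul_assoc]
    refine mul_le_mul_of_nonneg_left ?_ (by positivity)
    have h2 : ((k : ℝ) + 1) ^ (-(1 / 4) : ℝ) =
        ((k : ℝ) + 1) ^ (5 / 4 : ℝ) * ((k : ℝ) + 1) ^ (-(3 / 2) : ℝ) := by
      rw [← Real.rpow_add hk]; norm_num
    rw [h2, ← mul_assoc, ← Real.mul_rpow (by norm_num) hk.le]
    gcongr
    push_cast
    linarith
  · rw [← mul_sum]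
    have h1 := hsum.sum_le_tsum (range J) fun _ _ => by positivity
    have h2 : δ * ∑ j ∈ range J, ((j : ℝ) + 1) ^ (-(5 / 4) : ℝ) ≤ δ * (S + 1) := by
      gcongr; linarith
    have h3 : δ * (S + 1) = r / 2 := by rw [hδ]; field_simp
    linarith

end BumpCoefficients

section ExponentialSeries

variable {𝔸 : Type*} [NormedRing 𝔸] [NormedAlgebra ℂ 𝔸] [CompleteSpace 𝔸]

lemma summable_convolution {p q : ℤ → ℂ} (hp : Summable p) (hq : Summable q) :
    (∀ k, Summable fun m => p m * q (k - m)) ∧ Summable fun k => ∑' m, p m * q (k - m) := by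
  let e : ℤ × ℤ ≃ ℤ × ℤ := Equiv.mk (fun x => (x.2, x.1 - x.2)) (fun x => (x.1 + x.2, x.1))
    (fun x => by simp) (fun x => by simp)
  have h := e.summable_iff.2 (summable_mul_of_summable_norm hp.norm hq.norm)
  exact ⟨h.prod_factor, h.prod⟩

lemma tsum_smul_mul_tsum_smul {E : ℤ → 𝔸} (hE : ∀ m n, E (m + n) = E m * E n) {p q : ℤ → ℂ}
    (hp : Summable p) (hq : Summable q)
    (hpE : Summable fun n => ‖p n • E n‖) (hqE : Summable fun n => ‖q n • E n‖) :
    (∑' n, p n • E n) * (∑' n, q n • E n) = ∑' k, (∑' m, p m * q (k - m)) • E k := by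
  let e : ℤ × ℤ ≃ ℤ × ℤ := Equiv.mk (fun x => (x.2, x.1 - x.2)) (fun x => (x.1 + x.2, x.1))
    (fun x => by simp) (fun x => by simp)
  have hs := e.summable_iff.2 (summable_mul_of_summable_norm hpE hqE)
  have he : ∀ k m, ((fun x : ℤ × ℤ => (p x.1 • E x.1) * (q x.2 • E x.2)) ∘ e) (k, m) =
      (p m * q (k - m)) • E k := fun k m => by
    simp only [e, Function.comp, Equiv.coe_fn_mk]
    rw [smul_mul_smul_comm, ← hE, add_sub_cancel]
  rw [tsum_mul_tsum_of_summable_norm hpE hqE, ← e.tsum_eq]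
  refine (hs.tsum_prod).trans (tsum_congr fun k => ?_)
  simp only [he]
  exact ((summable_convolution hp hq).1 k).tsum_smul_const _

lemma convolution_eq_zero {p q : ℤ → ℂ} (hp : Summable p) (hq : Summable q)
    (h : ∀ θ : ℝ, (∑' n : ℤ, p n * Complex.exp (n * θ * Complex.I)) *
      (∑' n : ℤ, q n * Complex.exp (n * θ * Complex.I)) = 0) (k : ℤ) :
    ∑' m, p m * q (k - m) = 0 := by
  refine eq_zero_of_tsum_mul_exp_eq_zero (summable_convolution hp hq).2 (fun θ => ?_) k
  have hnorm : ∀ n : ℤ, ‖Complex.exp (n * θ * Complex.I)‖ = 1 := fun n => by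
    have : ((n : ℂ) * θ * Complex.I) = ((n * θ : ℝ) : ℂ) * Complex.I := by push_cast; ring
    rw [this, Complex.norm_exp_ofReal_mul_I]
  have h1 := tsum_smul_mul_tsum_smul (E := fun n : ℤ => Complex.exp (n * θ * Complex.I))
    (fun m n => by rw [← Complex.exp_add]; push_cast; ring_nf) hp hq
    (by simpa [hnorm] using hp.norm) (by simpa [hnorm] using hq.norm)
  simp only [smul_eq_mul] at h1
  rw [← h1, h]

end ExponentialSeries

section Growth

open Real

lemma growthSeries_mono {x y : ℝ} (hx : 0 ≤ x) (hxy : x ≤ y) : growthSeries x ≤ growthSeries y :=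
  (summable_growthSeries x).tsum_le_tsum (fun k => by gcongr) (summable_growthSeries y)

lemma one_le_growthSeries {x : ℝ} (hx : 0 ≤ x) : 1 ≤ growthSeries x := by
  simpa [growthSeries] using (summable_growthSeries x).le_tsum 0 fun k _ => by positivity

lemma growthSeries_le_mul_exp {x ε : ℝ} (hx : 0 ≤ x) (hε : 0 < ε) :
    growthSeries x ≤ exp ((ε⁻¹) ^ 2) * exp (ε * x) := by
  have h1 : HasSum (fun n : ℕ => (ε * x) ^ n / n.factorial) (exp (ε * x)) := by
    rw [Real.exp_eq_exp_ℝ]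
    exact NormedSpace.expSeries_div_hasSum_exp _
  rw [growthSeries, ← (h1.mul_left _).tsum_eq]
  refine (summable_growthSeries x).tsum_le_tsum (fun k => ?_) (h1.mul_left _).summable
  have hk : (1 : ℝ) ≤ k.factorial := by exact_mod_cast Nat.one_le_iff_ne_zero.2 k.factorial_ne_zero
  have h2 : (ε⁻¹) ^ k / √k.factorial ≤ exp ((ε⁻¹) ^ 2) := by
    refine abs_le_of_sq_le_sq' ?_ (exp_pos _).le |>.2
    rw [div_pow, sq_sqrt (by positivity), ← pow_mul, mul_comm k, pow_mul]
    refine (Real.pow_div_factorial_le_exp _ (by positivity) k).trans ?_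
    exact le_self_pow₀ (one_le_exp (by positivity)) two_ne_zero
  calc x ^ k / (k.factorial * √k.factorial)
      = ((ε⁻¹) ^ k / √k.factorial) * ((ε * x) ^ k / k.factorial) := by
        rw [mul_pow, inv_pow]; field_simp
    _ ≤ _ := by gcongr

lemma nonpos_of_exp_le_growthSeries {d c : ℝ} (hc : 0 ≤ c)
    (h : ∀ t : ℝ, 0 ≤ t → exp (t * d) ≤ growthSeries (t * c)) : d ≤ 0 := by
  by_contra! hd
  set ε := d / (2 * (c + 1)) with hε
  have hε0 : 0 < ε := by positivity
  have hεc : ε * c ≤ d / 2 := by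
    have : ε * (c + 1) = d / 2 := by rw [hε]; field_simp
    nlinarith
  set t := 2 / d * ((ε⁻¹) ^ 2 + 1) with ht
  have ht0 : 0 ≤ t := by positivity
  have h1 := (h t ht0).trans (growthSeries_le_mul_exp (by positivity) hε0)
  rw [← exp_add, exp_le_exp] at h1
  have h2 : t * d = 2 * ((ε⁻¹) ^ 2 + 1) := by rw [ht]; field_simp
  have h3 : ε * (t * c) ≤ t * d / 2 := by nlinarith
  linarith

end Growth

lemma AlgHom.map_exp_of_continuous {𝔸 𝔹 : Type*} [NormedRing 𝔸] [NormedAlgebra ℂ 𝔸]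
    [CompleteSpace 𝔸] [NormedRing 𝔹] [NormedAlgebra ℂ 𝔹] (f : 𝔸 →ₐ[ℂ] 𝔹) (hf : Continuous f)
    (x : 𝔸) : f (NormedSpace.exp x) = NormedSpace.exp (f x) := by
  let := NormedAlgebra.restrictScalars ℚ ℂ 𝔸
  let := NormedAlgebra.restrictScalars ℚ ℂ 𝔹
  exact NormedSpace.map_exp f hf x

section Characters

open Real WeakDual

variable {𝔸 : Type*} [NormedCommRing 𝔸] [NormedAlgebra ℂ 𝔸] [CompleteSpace 𝔸] {a : 𝔸} {c : ℝ}

lemma characterSpace_apply_exp (φ : characterSpace ℂ 𝔸) (x : 𝔸) :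
    φ (NormedSpace.exp x) = Complex.exp (φ x) := by
  rw [Complex.exp_eq_exp_ℂ]
  exact AlgHom.map_exp_of_continuous (CharacterSpace.toAlgHom φ) (map_continuous φ) x

lemma im_characterSpace_apply_eq_zero [NormOneClass 𝔸] (hc : 0 ≤ c)
    (h : ∀ t : ℝ, ‖NormedSpace.exp ((t * Complex.I : ℂ) • a)‖ ≤ growthSeries (|t| * c))
    (φ : characterSpace ℂ 𝔸) : (φ a).im = 0 := by
  have h1 : ∀ t : ℝ, exp (t * -(φ a).im) ≤ growthSeries (|t| * c) := fun t => by
    have h2 := (AlgHom.norm_apply_le_self φ _).trans (h t)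
    rw [characterSpace_apply_exp, Complex.norm_exp, map_smul] at h2
    simpa using h2
  refine le_antisymm ?_ ?_
  · refine nonpos_of_exp_le_growthSeries hc fun t ht => ?_
    simpa [abs_of_nonneg ht] using h1 (-t)
  · refine neg_nonpos.1 (nonpos_of_exp_le_growthSeries hc fun t ht => ?_)
    simpa [abs_of_nonneg ht] using h1 t

lemma bump_mul_translate_eq_zero {c : ℤ → ℝ}
    (hc : ∀ θ ∈ Set.Icc (π / 2) (2 * π - π / 2),
      ∑' n : ℤ, (c n : ℂ) * Complex.exp (n * θ * Complex.I) = 0) (θ : ℝ) :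
    (∑' n : ℤ, (c n : ℂ) * Complex.exp (n * θ * Complex.I)) *
      (∑' n : ℤ, (c n : ℂ) * Complex.exp (n * (θ + π : ℝ) * Complex.I)) = 0 := by
  set F : ℝ → ℂ := fun θ => ∑' n : ℤ, (c n : ℂ) * Complex.exp (n * θ * Complex.I) with hF
  have hper : Function.Periodic F (2 * π) := fun θ => tsum_congr fun n => by
    have : (n : ℂ) * ((θ + 2 * π : ℝ) : ℂ) * Complex.I =
        n * θ * Complex.I + n * (2 * π * Complex.I) := by push_cast; ring
    rw [this, Complex.exp_add, Complex.exp_int_mul_two_pi_mul_I, mul_one]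
  have hper2 : Function.Periodic (fun θ => F θ * F (θ + π)) (2 * π) := fun θ => by
    simp only [hper θ]
    rw [add_right_comm, hper]
  obtain ⟨y, hy, hy'⟩ := hper2.exists_mem_Ico₀ (by positivity) θ
  refine hy'.trans ?_
  simp only [mul_eq_zero]
  have hπ := pi_pos
  rcases lt_or_ge y (π / 2) with h1 | h1
  · exact Or.inr (hc _ ⟨by linarith [hy.1], by linarith⟩)
  rcases le_or_gt y (2 * π - π / 2) with h2 | h2
  · exact Or.inl (hc _ ⟨h1, h2⟩)
  · right
    rw [show y + π = y - π + 2 * π by ring, hper]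
    exact hc _ ⟨by linarith, by linarith [hy.2]⟩

lemma exists_mul_eq_zero_of_characterSpace_apply_ne [NormOneClass 𝔸] (hc : 0 ≤ c)
    (h : ∀ t : ℝ, ‖NormedSpace.exp ((t * Complex.I : ℂ) • a)‖ ≤ growthSeries (|t| * c))
    {φ ψ : characterSpace ℂ 𝔸} (hne : φ a ≠ ψ a) : ∃ S T : 𝔸, S ≠ 0 ∧ T ≠ 0 ∧ S * T = 0 := by
  obtain ⟨w, hw0, hws, hwz⟩ := exists_bump_coeff (r := π / 2) (by positivity)
  have hφ : φ a = ((φ a).re : ℝ) := Complex.ext (by simp)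
    (by simpa using im_characterSpace_apply_eq_zero hc h φ)
  have hψ : ψ a = ((ψ a).re : ℝ) := Complex.ext (by simp)
    (by simpa using im_characterSpace_apply_eq_zero hc h ψ)
  set μ := (φ a).re
  set ν := (ψ a).re
  have hμν : μ - ν ≠ 0 := fun h0 => hne (by rw [hφ, hψ, sub_eq_zero.1 h0])
  set τ := π / (μ - ν) with hτ
  let E : ℤ → 𝔸 := fun n => NormedSpace.exp (((n * τ : ℝ) * Complex.I : ℂ) • a)
  have hE : ∀ m n, E (m + n) = E m * E n := fun m n => by
    let := NormedAlgebra.restrictScalars ℚ ℂ 𝔸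
    simp only [E]
    rw [← NormedSpace.exp_add, ← add_smul]
    push_cast
    ring_nf
  have hEφ : ∀ (χ : characterSpace ℂ 𝔸) (x : ℝ), χ a = x → ∀ n,
      χ (E n) = Complex.exp (n * (τ * x : ℝ) * Complex.I) := fun χ x hx n => by
    rw [characterSpace_apply_exp, map_smul, hx, smul_eq_mul]
    push_cast
    ring_nf
  have hEn : ∀ n : ℤ, ‖E n‖ ≤ growthSeries ((|τ| * c + 1) * |(n : ℝ)|) := fun n => by
    refine (h _).trans (growthSeries_mono (by positivity) ?_)
    rw [abs_mul]
    nlinarith [abs_nonneg (n : ℝ)]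
  have hws := hws (|τ| * c + 1) (by positivity)
  let p : ℝ → ℤ → ℂ := fun α n => w n * Complex.exp (n * α * Complex.I)
  have hpn : ∀ α n, ‖p α n‖ = |w n| := fun α n => by
    have : ((n : ℂ) * α * Complex.I) = ((n * α : ℝ) : ℂ) * Complex.I := by push_cast; ring
    rw [norm_mul, this, Complex.norm_exp_ofReal_mul_I, mul_one, Complex.norm_real, norm_eq_abs]
  have hp : ∀ α, Summable (p α) := fun α => by
    refine Summable.of_norm_bounded hws fun n => ?_
    rw [hpn]
    exact le_mul_of_one_le_right (abs_nonneg _) (one_le_growthSeries (by positivity))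
  have hpE : ∀ α, Summable fun n => ‖p α n • E n‖ := fun α => by
    refine Summable.of_nonneg_of_le (fun _ => norm_nonneg _) (fun n => ?_) hws
    rw [norm_smul, hpn]
    exact mul_le_mul_of_nonneg_left (hEn n) (abs_nonneg _)
  have hpF : ∀ α θ : ℝ, ∑' n : ℤ, p α n * Complex.exp (n * θ * Complex.I) =
      ∑' n : ℤ, (w n : ℂ) * Complex.exp (n * (α + θ : ℝ) * Complex.I) := fun α θ =>
    tsum_congr fun n => by
      rw [mul_assoc, ← Complex.exp_add]
      push_cast
      ring_nf
  obtain ⟨θ, hθ⟩ : ∃ θ : ℝ, ∑' n : ℤ, (w n : ℂ) * Complex.exp (n * θ * Complex.I) ≠ 0 := by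
    by_contra! hcon
    have hw : Summable fun n => (w n : ℂ) := by simpa [p] using hp 0
    have := eq_zero_of_tsum_mul_exp_eq_zero hw hcon 0
    simp [hw0] at this
  have hT : ∀ (χ : characterSpace ℂ 𝔸) (x : ℝ), χ a = x →
      ∑' n, p (θ - τ * x) n • E n ≠ 0 := fun χ x hx h0 => by
    have h1 := congrArg χ h0
    rw [map_zero, (hpE _).of_norm.map_tsum χ (map_continuous χ)] at h1
    simp only [map_smul, hEφ χ x hx, smul_eq_mul] at h1
    rw [hpF, sub_add_cancel] at h1
    exact hθ h1
  refine ⟨_, _, hT φ μ hφ, hT ψ ν hψ, ?_⟩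
  rw [tsum_smul_mul_tsum_smul hE (hp _) (hp _) (hpE _) (hpE _)]
  have hconv := convolution_eq_zero (hp (θ - τ * μ)) (hp (θ - τ * ν)) fun θ' => by
    rw [hpF, hpF]
    have hτ' : θ - τ * ν + θ' = θ - τ * μ + θ' + π := by
      have : τ * (μ - ν) = π := by rw [hτ]; field_simp
      linarith
    rw [hτ']
    exact bump_mul_translate_eq_zero hwz _
  simp only [hconv, zero_smul, tsum_zero]

end Characters

section Dichotomy

open WeakDual Filter Topology

lemma exists_mul_eq_zero_or_quasinilpotent {𝔸 : Type*} [NormedCommRing 𝔸] [NormedAlgebra ℂ 𝔸]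
    [CompleteSpace 𝔸] [NormOneClass 𝔸] {a : 𝔸} {c : ℝ} (hc : 0 ≤ c)
    (h : ∀ t : ℝ, ‖NormedSpace.exp ((t * Complex.I : ℂ) • a)‖ ≤ growthSeries (|t| * c)) :
    (∃ S T : 𝔸, S ≠ 0 ∧ T ≠ 0 ∧ S * T = 0) ∨
      ∃ μ : ℝ, ∀ ε : ℝ, 0 < ε → ∀ᶠ n : ℕ in atTop, ‖(a - algebraMap ℂ 𝔸 μ) ^ n‖ ≤ ε ^ n := by
  have := NormOneClass.nontrivial (G := 𝔸)
  by_cases hne : ∃ φ ψ : characterSpace ℂ 𝔸, φ a ≠ ψ a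
  · obtain ⟨φ, ψ, hφψ⟩ := hne
    exact Or.inl (exists_mul_eq_zero_of_characterSpace_apply_ne hc h hφψ)
  push Not at hne
  obtain ⟨z, hz⟩ := spectrum.nonempty a
  obtain ⟨φ, rfl⟩ := CharacterSpace.mem_spectrum_iff_exists.1 hz
  refine Or.inr ⟨(φ a).re, fun ε hε => ?_⟩
  have hφ : ((φ a).re : ℂ) = φ a :=
    Complex.ext (by simp) (by simpa using (im_characterSpace_apply_eq_zero hc h φ).symm)
  rw [hφ]
  set b := a - algebraMap ℂ 𝔸 (φ a) with hb
  have hr : spectralRadius ℂ b = 0 := by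
    refine le_antisymm (iSup₂_le fun w hw => ?_) bot_le
    obtain ⟨ψ, rfl⟩ := CharacterSpace.mem_spectrum_iff_exists.1 hw
    have : ψ b = 0 := by rw [hb, map_sub, AlgHomClass.commutes, hne ψ φ]; simp
    simp [this]
  have hlim := spectrum.pow_norm_pow_one_div_tendsto_nhds_spectralRadius b
  rw [hr] at hlim
  filter_upwards [hlim.eventually_lt_const (ENNReal.ofReal_pos.2 hε), eventually_gt_atTop 0]
    with n hn hn0
  rw [ENNReal.ofReal_lt_ofReal_iff hε] at hn
  have h1 := pow_le_pow_left₀ (by positivity) hn.le n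
  rwa [one_div, Real.rpow_inv_natCast_pow (norm_nonneg _) hn0.ne'] at h1

/-- If `t ↦ exp (itA)` grows slowly and `A` has no nontrivial closed invariant subspace, then `A`
is a real translate of a quasinilpotent operator. -/
lemma exists_quasinilpotent_sub {H : Type*} [NormedAddCommGroup H] [NormedSpace ℂ H]
    [CompleteSpace H] [Nontrivial H] {A : H →L[ℂ] H} {c : ℝ} (hc : 0 ≤ c)
    (h : ∀ t : ℝ, ‖NormedSpace.exp ((t * Complex.I : ℂ) • A)‖ ≤ growthSeries (|t| * c))
    (hinv : ∀ M : Submodule ℂ H, IsClosed (M : Set H) → (∀ x ∈ M, A x ∈ M) → M = ⊥ ∨ M = ⊤) :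
    ∃ μ : ℝ, ∀ ε : ℝ, 0 < ε → ∀ᶠ n : ℕ in atTop, ‖(A - algebraMap ℂ _ (μ : ℂ)) ^ n‖ ≤ ε ^ n := by
  let 𝒜 := Algebra.elemental ℂ A
  let a : 𝒜 := ⟨A, Algebra.elemental.self_mem ℂ A⟩
  have hexp : ∀ t : ℝ, ‖NormedSpace.exp ((t * Complex.I : ℂ) • a)‖ ≤ growthSeries (|t| * c) := by
    intro t
    refine le_of_eq_of_le ?_ (h t)
    exact congrArg norm (AlgHom.map_exp_of_continuous 𝒜.val continuous_subtype_val _)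
  let : NormedCommRing 𝒜 :=
    { (inferInstance : NormedRing 𝒜) with
      mul_comm := (inferInstance : CommRing 𝒜).mul_comm }
  let : NormedAlgebra ℂ 𝒜 := SubalgebraClass.toNormedAlgebra 𝒜
  have : NormOneClass 𝒜 := ⟨norm_one (α := H →L[ℂ] H)⟩
  rcases exists_mul_eq_zero_or_quasinilpotent hc hexp with ⟨S, T, hS, hT, hST⟩ | ⟨μ, hμ⟩
  · exfalso
    have hcomm : A * (S : H →L[ℂ] H) = S * A := congrArg Subtype.val (mul_comm a S)
    have hST' : (S : H →L[ℂ] H) * (T : H →L[ℂ] H) = 0 := congrArg Subtype.val hST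
    rcases hinv (S : H →L[ℂ] H).ker (S : H →L[ℂ] H).isClosed_ker (fun x hx => by
      have h1 := congrArg (fun X : H →L[ℂ] H => X x) hcomm
      have h2 : (S : H →L[ℂ] H) x = 0 := hx
      have h3 : A ((S : H →L[ℂ] H) x) = (S : H →L[ℂ] H) (A x) := h1
      rw [h2, map_zero] at h3
      exact h3.symm) with hker | hker
    · refine hT (Subtype.ext (ContinuousLinearMap.ext fun x => ?_))
      have : (T : H →L[ℂ] H) x ∈ (S : H →L[ℂ] H).ker :=
        congrArg (fun X : H →L[ℂ] H => X x) hST'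
      rw [hker] at this
      exact this
    · refine hS (Subtype.ext (ContinuousLinearMap.ext fun x => ?_))
      have : x ∈ (S : H →L[ℂ] H).ker := hker ▸ Submodule.mem_top
      exact this
  · exact ⟨μ, hμ⟩

end Dichotomy

section Hilden

open Filter Topology Polynomial

variable {H : Type*} [NormedAddCommGroup H] [NormedSpace ℂ H]

lemma exists_aeval_apply_near {A : H →L[ℂ] H}
    (hinv : ∀ M : Submodule ℂ H, IsClosed (M : Set H) → (∀ x ∈ M, A x ∈ M) → M = ⊥ ∨ M = ⊤)
    {y : H} (hy : y ≠ 0) (x₀ : H) : ∃ p : ℂ[X], ‖aeval A p y - x₀‖ < 1 := by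
  let φ : ℂ[X] →ₗ[ℂ] H :=
    (ContinuousLinearMap.apply ℂ H y : (H →L[ℂ] H) →L[ℂ] H).toLinearMap ∘ₗ
      (aeval A : ℂ[X] →ₐ[ℂ] (H →L[ℂ] H)).toLinearMap
  have hφ : ∀ p, φ p = aeval A p y := fun p => rfl
  have hAφ : ∀ x ∈ φ.range, A x ∈ φ.range := by
    rintro _ ⟨p, rfl⟩
    exact ⟨X * p, by simp [hφ]⟩
  have hcl := hinv φ.range.topologicalClosure φ.range.isClosed_topologicalClosure
    (fun x hx => map_mem_closure A.continuous hx hAφ)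
  have hymem : y ∈ φ.range.topologicalClosure :=
    φ.range.le_topologicalClosure ⟨1, by simp [hφ]⟩
  have htop := hcl.resolve_left fun h => hy (by simpa [h] using hymem)
  have hx₀ : x₀ ∈ closure (φ.range : Set H) := by
    have : x₀ ∈ φ.range.topologicalClosure := htop ▸ Submodule.mem_top
    exact this
  obtain ⟨_, ⟨p, rfl⟩, hp⟩ := Metric.mem_closure_iff.1 hx₀ 1 one_pos
  exact ⟨p, by rwa [dist_comm, dist_eq_norm] at hp⟩

/-- Argument of Hilden: a nonzero compact quasinilpotent operator has a nontrivial closed invariant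
subspace. -/
lemma eq_zero_of_isCompactOperator_of_quasinilpotent {A : H →L[ℂ] H} (hA : IsCompactOperator A)
    (hq : ∀ ε : ℝ, 0 < ε → ∀ᶠ n : ℕ in atTop, ‖A ^ n‖ ≤ ε ^ n)
    (hinv : ∀ M : Submodule ℂ H, IsClosed (M : Set H) → (∀ x ∈ M, A x ∈ M) → M = ⊥ ∨ M = ⊤) :
    A = 0 := by
  by_contra hA0
  obtain ⟨v, hv⟩ : ∃ v, A v ≠ 0 := by
    by_contra! h
    exact hA0 (ContinuousLinearMap.ext h)
  set x₀ : H := (((‖A‖ + 1) / ‖A v‖ : ℝ) : ℂ) • v with hx₀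
  have hAx₀ : ‖A x₀‖ = ‖A‖ + 1 := by
    have := norm_ne_zero_iff.2 hv
    rw [hx₀, map_smul, norm_smul, Complex.norm_real, Real.norm_of_nonneg (by positivity)]
    field_simp
  have hone : ∀ x ∈ Metric.closedBall x₀ 1, 1 ≤ ‖A x‖ := fun x hx => by
    have h1 := A.le_opNorm (x₀ - x)
    rw [mem_closedBall_iff_norm'] at hx
    have h2 := norm_sub_norm_le (A x₀) (A x)
    rw [← map_sub, hAx₀] at h2
    nlinarith [norm_nonneg A]
  have hK : IsCompact (closure (A '' Metric.closedBall x₀ 1)) :=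
    IsCompactOperator.isCompact_closure_image_of_bounded (f := (A : H →ₗ[ℂ] H)) hA
      Metric.isBounded_closedBall
  have hK1 : ∀ y ∈ closure (A '' Metric.closedBall x₀ 1), y ≠ 0 := fun y hy => by
    have : 1 ≤ ‖y‖ := closure_minimal (t := {y : H | 1 ≤ ‖y‖})
      (by rintro _ ⟨x, hx, rfl⟩; exact hone x hx)
      (isClosed_le continuous_const continuous_norm) hy
    exact norm_pos_iff.1 (by linarith)
  obtain ⟨t, ht⟩ := hK.elim_finite_subcover (fun p : ℂ[X] => {y : H | ‖aeval A p y - x₀‖ < 1})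
    (fun p => isOpen_lt (by fun_prop) continuous_const)
    (fun y hy => Set.mem_iUnion.2 (exists_aeval_apply_near hinv (hK1 y hy) x₀))
  set C : ℝ := 1 + ∑ p ∈ t, ‖aeval A p‖ with hC
  have hsum0 : 0 ≤ ∑ p ∈ t, ‖aeval A p‖ := sum_nonneg fun _ _ => norm_nonneg _
  have hC0 : 0 < C := by linarith
  have hiter : ∀ m : ℕ, ∃ S : H →L[ℂ] H, Commute A S ∧ ‖S‖ ≤ C ^ m ∧
      S ((A ^ m) x₀) ∈ Metric.closedBall x₀ 1 := by
    intro m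
    induction m with
    | zero =>
      exact ⟨1, Commute.one_right A, by rw [pow_zero]; exact ContinuousLinearMap.norm_id_le,
        by simp⟩
    | succ m ih =>
      obtain ⟨S, hS, hSn, hSx⟩ := ih
      have h1 := ht (subset_closure ⟨_, hSx, rfl⟩)
      simp only [Set.mem_iUnion] at h1
      obtain ⟨p, hp, hpx⟩ := h1
      refine ⟨aeval A p * S, ?_, ?_, ?_⟩
      · refine Commute.mul_right ?_ hS
        simpa using (Commute.all X p).map (aeval A)
      · rw [pow_succ']
        refine (norm_mul_le _ _).trans (mul_le_mul ?_ hSn (norm_nonneg _) hC0.le)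
        have := single_le_sum (f := fun p => ‖aeval A p‖) (fun _ _ => norm_nonneg _) hp
        linarith
      · have h2 : (aeval A p * S) ((A ^ (m + 1)) x₀) = aeval A p (A (S ((A ^ m) x₀))) := by
          have h3 : A (S ((A ^ m) x₀)) = (A * S) ((A ^ m) x₀) := rfl
          rw [h3, hS.eq, pow_succ']; rfl
        rw [h2, mem_closedBall_iff_norm]
        exact le_of_lt hpx
  have hsmall : ‖x₀‖ - 1 ≤ 0 := by
    have hlim : Tendsto (fun m : ℕ => (1 / 2 : ℝ) ^ m * ‖x₀‖) atTop (𝓝 0) := by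
      simpa using (tendsto_pow_atTop_nhds_zero_of_lt_one (by norm_num : (0 : ℝ) ≤ 1 / 2)
        (by norm_num)).mul_const ‖x₀‖
    refine ge_of_tendsto hlim ?_
    filter_upwards [hq (1 / (2 * C)) (by positivity)] with m hm
    obtain ⟨S, -, hSn, hSx⟩ := hiter m
    rw [mem_closedBall_iff_norm'] at hSx
    have h1 := norm_sub_norm_le x₀ (S ((A ^ m) x₀))
    have h2 : ‖S ((A ^ m) x₀)‖ ≤ (1 / 2 : ℝ) ^ m * ‖x₀‖ := by
      refine (S.le_opNorm _).trans ?_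
      calc ‖S‖ * ‖(A ^ m) x₀‖ ≤ C ^ m * ((1 / (2 * C)) ^ m * ‖x₀‖) := by
            gcongr
            exact ((A ^ m).le_opNorm _).trans (by gcongr)
        _ = _ := by
            rw [← mul_assoc, ← mul_pow]
            congr 2
            field_simp
    linarith
  have h0 := hone 0 (by rw [mem_closedBall_iff_norm', sub_zero]; linarith)
  rw [map_zero, norm_zero] at h0
  linarith

end Hilden

section CompactPerturbation

open Filter Topology

variable {H : Type*} [NormedAddCommGroup H] [InnerProductSpace ℂ H]

lemma tendsto_norm_one_sub_spanProj_mul {K : H →L[ℂ] H} (hK : IsCompactOperator K) :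
    Tendsto (fun F : Finset H => ‖(1 - spanProj F) * K‖) atTop (𝓝 0) := by
  obtain ⟨C, hC, hKC⟩ := hK.image_closedBall_subset_compact (f := (K : H →ₗ[ℂ] H)) 1
  rw [Metric.tendsto_nhds]
  intro ε hε
  obtain ⟨t, -, ht, hCt⟩ := hC.finite_cover_balls (e := ε / 4) (by positivity)
  have hev : ∀ᶠ F : Finset H in atTop, ∀ y ∈ t, ‖y - spanProj F y‖ < ε / 4 := by
    rw [Filter.eventually_all_finite ht]
    intro y _
    have := ((tendsto_spanProj y).const_sub y).norm
    rw [sub_self, norm_zero] at this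
    exact this.eventually_lt_const (by positivity)
  filter_upwards [hev] with F hF
  rw [dist_zero_right, norm_norm]
  refine lt_of_le_of_lt (b := 3 * ε / 4) ?_ (by linarith)
  refine ContinuousLinearMap.opNorm_le_of_unit_norm (𝕜 := ℂ) (by positivity) fun x hx => ?_
  have hKx : K x ∈ C := hKC ⟨x, by simp [hx], rfl⟩
  obtain ⟨y, hy, hxy⟩ := Set.mem_iUnion₂.1 (hCt hKx)
  rw [mem_ball_iff_norm] at hxy
  have h1 := hF y hy
  have h2 := norm_spanProj_apply_le F (K x - y)
  calc ‖((1 - spanProj F) * K) x‖ = ‖(K x - y) + (y - spanProj F y) - spanProj F (K x - y)‖ := by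
        congr 1
        simp
    _ ≤ ‖K x - y‖ + ‖y - spanProj F y‖ + ‖spanProj F (K x - y)‖ :=
        (norm_sub_le _ _).trans (by gcongr; exact norm_add_le _ _)
    _ ≤ _ := by linarith

lemma isCompactOperator_pow_sub_pow {L A : H →L[ℂ] H} (h : IsCompactOperator (L - A)) (n : ℕ) :
    IsCompactOperator (L ^ n - A ^ n) := by
  induction n with
  | zero => simpa using isCompactOperator_zero
  | succ n ih =>
    have h1 : L ^ (n + 1) - A ^ (n + 1) = L ∘L (L ^ n - A ^ n) + (L - A) ∘L (A ^ n) := by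
      change _ = L * (L ^ n - A ^ n) + (L - A) * A ^ n
      rw [pow_succ', pow_succ', mul_sub, sub_mul]
      abel
    rw [h1]
    exact (ih.clm_comp L).add (h.comp_clm (A ^ n))

variable [CompleteSpace H]

lemma norm_one_sub_spanProj_mul_pow_le {L : H →L[ℂ] H} (hL : IsSelfAdjoint L) (F : Finset H)
    (m : ℕ) : ‖(1 - spanProj F) * L‖ ^ 2 ^ m ≤ ‖(1 - spanProj F) * L ^ 2 ^ m‖ := by
  have hQ : IsSelfAdjoint (1 - spanProj F) := (IsSelfAdjoint.one _).sub (isSelfAdjoint_spanProj F)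
  have hQ1 : ‖1 - spanProj F‖ ≤ 1 := by
    have := (Submodule.span ℂ (F : Set H))ᗮ.starProjection_norm_le
    rwa [Submodule.starProjection_orthogonal'] at this
  induction m with
  | zero => simp
  | succ m ih =>
    rw [pow_succ, pow_mul]
    refine (pow_le_pow_left₀ (by positivity) ih 2).trans ?_
    rw [pow_two, ← CStarRing.norm_self_mul_star, star_mul, (hL.pow _).star_eq, hQ.star_eq,
      pow_mul, pow_two, ← mul_assoc, ← mul_assoc]
    refine (norm_mul_le _ _).trans ?_
    exact mul_le_of_le_one_right (norm_nonneg _) hQ1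

/-- A self-adjoint compact perturbation of a quasinilpotent operator is compact. -/
lemma isCompactOperator_of_quasinilpotent {L A : H →L[ℂ] H} (hL : IsSelfAdjoint L)
    (hLA : IsCompactOperator (L - A))
    (hq : ∀ ε : ℝ, 0 < ε → ∀ᶠ n : ℕ in atTop, ‖A ^ n‖ ≤ ε ^ n) : IsCompactOperator L := by
  have hlim : Tendsto (fun F : Finset H => spanProj F * L) atTop (𝓝 L) := by
    rw [tendsto_iff_norm_sub_tendsto_zero, Metric.tendsto_nhds]
    intro ε hε
    obtain ⟨m, hm⟩ := ((tendsto_pow_atTop_atTop_of_one_lt one_lt_two).eventually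
      (hq (ε / 4) (by positivity))).exists
    have hK := (tendsto_norm_one_sub_spanProj_mul
      (isCompactOperator_pow_sub_pow hLA (2 ^ m))).eventually_le_const
      (show 0 < (ε / 4) ^ 2 ^ m by positivity)
    filter_upwards [hK] with F hF
    rw [dist_zero_right, norm_norm, ← norm_neg, neg_sub]
    have hQ1 : ‖1 - spanProj F‖ ≤ 1 := by
      have := (Submodule.span ℂ (F : Set H))ᗮ.starProjection_norm_le
      rwa [Submodule.starProjection_orthogonal'] at this
    have h1 : ‖(1 - spanProj F) * L‖ ^ 2 ^ m ≤ (ε / 2) ^ 2 ^ m := by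
      refine (norm_one_sub_spanProj_mul_pow_le hL F m).trans ?_
      rw [← sub_add_cancel (L ^ 2 ^ m) (A ^ 2 ^ m), mul_add]
      refine (norm_add_le _ _).trans ?_
      have h2 : ‖(1 - spanProj F) * A ^ 2 ^ m‖ ≤ (ε / 4) ^ 2 ^ m :=
        (norm_mul_le _ _).trans ((mul_le_of_le_one_left (norm_nonneg _) hQ1).trans hm)
      have h3 : (ε / 2) ^ 2 ^ m = (ε / 4) ^ 2 ^ m * 2 ^ 2 ^ m := by rw [← mul_pow]; ring
      have h4 : (2 : ℝ) ≤ 2 ^ 2 ^ m := le_self_pow₀ one_le_two (by positivity)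
      rw [h3]
      nlinarith [show 0 < (ε / 4) ^ 2 ^ m by positivity]
    have h5 := le_of_pow_le_pow_left₀ (by positivity) (by positivity) h1
    rw [sub_mul, one_mul] at h5
    linarith
  exact isCompactOperator_of_tendsto hlim
    (Eventually.of_forall fun F => (isCompactOperator_spanProj F).comp_clm L)

end CompactPerturbation

end

/-- Theorem 8.8: every operator `A = L + iB` with `L` bounded self-adjoint and
`B` self-adjoint Hilbert–Schmidt on a complex separable Hilbert space of
dimension at least 2 has a nontrivial closed invariant subspace. -/
theorem stmt_12 {H : Type*} [NormedAddCommGroup H] [InnerProductSpace ℂ H]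
    [CompleteSpace H] [TopologicalSpace.SeparableSpace H]
    (hdim : 2 ≤ Module.rank ℂ H)
    (L B : H →L[ℂ] H) (hL : IsSelfAdjoint L) (hB : IsSelfAdjoint B)
    (hHS : ∃ (s : Set H) (e : HilbertBasis s ℂ H), Summable fun i => ‖B (e i)‖ ^ 2)
    (A : H →L[ℂ] H) (hA : A = L + Complex.I • B) :
    ∃ M : Submodule ℂ H, IsClosed (M : Set H) ∧ M ≠ ⊥ ∧ M ≠ ⊤ ∧
      ∀ x ∈ M, A x ∈ M := by
  by_contra hcon
  have hinv : ∀ M : Submodule ℂ H, IsClosed (M : Set H) → (∀ x ∈ M, A x ∈ M) →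
      M = ⊥ ∨ M = ⊤ := fun M hM hAM => by
    by_contra! hne
    exact hcon ⟨M, hM, hne.1, hne.2, hAM⟩
  have hev : ∀ (x : H) (μ : ℂ), A x = μ • x → x = 0 := fun x μ hx => by
    rcases hinv (ℂ ∙ x) (Submodule.closed_of_finiteDimensional _) (fun y hy => by
      obtain ⟨a, rfl⟩ := Submodule.mem_span_singleton.1 hy
      rw [map_smul, hx]
      exact Submodule.smul_mem _ _ (Submodule.smul_mem _ _ (Submodule.mem_span_singleton_self x)))
      with h | h
    · exact Submodule.span_singleton_eq_bot.1 h
    · have h1 := rank_span_le (R := ℂ) ({x} : Set H)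
      rw [h, rank_top, Cardinal.mk_singleton] at h1
      exact absurd (hdim.trans h1) (by norm_num)
  have : Nontrivial H := rank_pos_iff_nontrivial (R := ℂ) |>.1 (two_pos.trans_le hdim)
  obtain ⟨s, e, hs⟩ := hHS
  have hBc := isCompactOperator_of_hilbertSchmidt hB e hs
  have hc : 0 ≤ 2 * √(∑' i, ‖B (e i)‖ ^ 2) := by positivity
  have hexp : ∀ t : ℝ, ‖NormedSpace.exp ((t * Complex.I : ℂ) • A)‖ ≤
      growthSeries (|t| * (2 * √(∑' i, ‖B (e i)‖ ^ 2))) := fun t =>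
    norm_exp_le_growthSeries (q := t ^ 2 * ‖A‖ ^ 2) (by positivity) (by positivity) fun r m =>
      norm_add_smul_pow_le hc (fun n b hb => sum_norm_inner_sub_conj_sq_le hL hB hA e hs hb)
        (fun ε hε => eventually_abs_im_lt hL hBc hA hev hε) r t m
  obtain ⟨μ, hμ⟩ := exists_quasinilpotent_sub hc hexp hinv
  have hL' : IsSelfAdjoint (L - algebraMap ℂ (H →L[ℂ] H) μ) :=
    hL.sub (IsSelfAdjoint.algebraMap _ (Complex.conj_ofReal μ))
  have hLA : L - algebraMap ℂ (H →L[ℂ] H) μ - (A - algebraMap ℂ (H →L[ℂ] H) μ) =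
      -(Complex.I • B) := by
    rw [hA]
    abel
  have hIB : IsCompactOperator (Complex.I • B) := hBc.smul Complex.I
  have hA' : IsCompactOperator (A - algebraMap ℂ (H →L[ℂ] H) μ) := by
    have hsum : A - algebraMap ℂ (H →L[ℂ] H) μ =
        (L - algebraMap ℂ (H →L[ℂ] H) μ) + Complex.I • B := by
      rw [hA]
      abel
    rw [hsum]
    exact (isCompactOperator_of_quasinilpotent hL' (by rw [hLA]; exact hIB.neg) hμ).add hIB
  have hA0 := eq_zero_of_isCompactOperator_of_quasinilpotent hA' hμ fun M hM hAM =>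
    hinv M hM fun x hx => by
      have := M.add_mem (hAM x hx) (M.smul_mem (μ : ℂ) hx)
      simpa [Algebra.algebraMap_eq_smul_one] using this
  obtain ⟨x, hx⟩ := exists_ne (0 : H)
  refine hx (hev x μ ?_)
  rw [sub_eq_zero.1 hA0, Algebra.algebraMap_eq_smul_one]
  rfl
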